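/- arXiv:2601.14621 — 2 statements merged into one kernel-verified Lean document; each statement's English description precedes it below -/
import Mathlib

section
/- KL-divergence lower bound on the square error for the AWGN model: fix naturals 1 ≤ k < N and σ² > 0, let x be uniform on X_k^N(U), ω have i.i.d. N(0, σ̃²) entries with σ̃² = σ²/log(N/k), y = x + ω, and let p be the law of y on ℝ^N. Let q be the N-fold product of the Gaussian measure N(0, λ·σ̃²) with λ = 1 + k·S̄/(N·σ̃²), S̄ = (1/M)∑_{m=1}^M u_m², and assume the Kullback–Leibler divergence D = D(p ‖ q) is finite. Then for every measurable estimator x̂ : ℝ^N → ℝ^N and every α ∈ (0, 1/(2u_max²)): (1/k)·E[‖x − x̂(y)‖₂²] ≥ (1/α)·( C_N(α)·e^{−2D} − 1 ), where C_N(α) = (1 − u_max⁴α²)·exp(α·S̄) / ( 1 + f(α)·{ (1 + (N/k − 1)^{−1})^k − 1 } )² and f(α) = ((1 − u_max⁴α²)/(1 − 2u_max²α))^{1/2} − 1. -/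
open MeasureTheory ProbabilityTheory Real Filter Finset
open scoped ENNReal NNReal Classical

/-- The finite set of vectors indexed by `ι` having exactly `w` nonzero entries,
each nonzero entry lying in the finite set `U`. -/
noncomputable def sparseVecs (U : Finset ℝ) (ι : Type) [Fintype ι] [DecidableEq ι]
    (w : ℕ) : Finset (ι → ℝ) :=
  (Fintype.piFinset fun _ : ι => insert (0 : ℝ) U).filter
    fun x => (Finset.univ.filter fun i => x i ≠ 0).card = w

/-- Uniform probability measure on a finite set. -/
noncomputable def uniformOn {α : Type*} [MeasurableSpace α] (S : Finset α) : Measure α :=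
  (S.card : ℝ≥0∞)⁻¹ • ∑ x ∈ S, Measure.dirac x

/-- Kullback–Leibler divergence of `ν` from `μ` (Mathlib's `klDiv`). -/
noncomputable def klDiv {α : Type*} [MeasurableSpace α] (μ ν : Measure α) : ℝ≥0∞ :=
  if μ ≪ ν ∧ Integrable (llr μ ν) μ then ENNReal.ofReal (∫ x, llr μ ν x ∂μ) else ⊤

lemma gaussianReal_withDensity_of_pdf_eq {m m' : ℝ} {v v' : ℝ≥0} (hv : v ≠ 0) (hv' : v' ≠ 0)
    {f : ℝ → ℝ} (hf : Measurable f)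
    (h : ∀ y, gaussianPDFReal m v y * f y = gaussianPDFReal m' v' y) :
    (gaussianReal m v).withDensity (fun y => ENNReal.ofReal (f y)) = gaussianReal m' v' := by
  rw [gaussianReal_of_var_ne_zero _ hv, gaussianReal_of_var_ne_zero _ hv',
    ← withDensity_mul _ (measurable_gaussianPDF _ _) hf.ennreal_ofReal]
  congr 1
  ext y
  simp only [Pi.mul_apply, gaussianPDF]
  rw [← ENNReal.ofReal_mul (gaussianPDFReal_nonneg _ _ _), h]

lemma gaussianReal_withDensity_exp (s : ℝ≥0) (c : ℝ) :
    (gaussianReal 0 s).withDensity (fun y => ENNReal.ofReal (exp (c * y - s / 2 * (c * c)))) =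
      gaussianReal (s * c) s := by
  rcases eq_or_ne s 0 with rfl | hs
  · have : Measurable fun y : ℝ => ENNReal.ofReal (exp (c * y)) := by fun_prop
    simp only [gaussianReal_zero_var, NNReal.coe_zero, zero_mul, zero_div, sub_zero]
    ext t ht
    rw [withDensity_apply _ ht, setLIntegral_dirac' this ht]
    simp [ht, Set.indicator_apply]
  · refine gaussianReal_withDensity_of_pdf_eq hs hs (by fun_prop) ?_
    intro y
    have : (s : ℝ) ≠ 0 := by exact_mod_cast hs
    rw [gaussianPDFReal, gaussianPDFReal, mul_assoc, ← Real.exp_add]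
    congr 2
    field_simp
    ring

/-- A product of densities is the density of the product measure. -/
lemma pi_withDensity_ofReal {ι : Type*} [Fintype ι] {μ ν : ι → Measure ℝ}
    [∀ i, IsProbabilityMeasure (μ i)] [∀ i, IsProbabilityMeasure (ν i)] {f : ι → ℝ → ℝ}
    (hf : ∀ i, Measurable (f i)) (hf0 : ∀ i y, 0 ≤ f i y)
    (h : ∀ i, (μ i).withDensity (fun y => ENNReal.ofReal (f i y)) = ν i) :
    (Measure.pi μ).withDensity (fun y => ENNReal.ofReal (∏ i, f i (y i))) = Measure.pi ν := by
  have hintg : ∀ i, Integrable (f i) (μ i) := by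
    intro i
    refine ⟨(hf i).aestronglyMeasurable, ?_⟩
    rw [hasFiniteIntegral_iff_ofReal (ae_of_all _ (hf0 i)), ← setLIntegral_univ,
      ← withDensity_apply _ MeasurableSet.univ, h i]
    simp
  refine (Measure.pi_eq fun S hS => ?_).symm
  rw [withDensity_apply _ (MeasurableSet.univ_pi hS), ← lintegral_indicator (MeasurableSet.univ_pi hS)]
  have e1 : ∀ y : ι → ℝ, (Set.univ.pi S).indicator
      (fun y => ENNReal.ofReal (∏ i, f i (y i))) y =
      ENNReal.ofReal (∏ i, (S i).indicator (f i) (y i)) := by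
    intro y
    by_cases hy : y ∈ Set.univ.pi S
    · rw [Set.indicator_of_mem hy]
      congr 1
      refine Finset.prod_congr rfl fun i _ => ?_
      rw [Set.indicator_of_mem (hy i trivial)]
    · rw [Set.indicator_of_notMem hy]
      simp only [Set.mem_univ_pi, not_forall] at hy
      obtain ⟨i, hi⟩ := hy
      rw [Finset.prod_eq_zero (Finset.mem_univ i) (Set.indicator_of_notMem hi _), ENNReal.ofReal_zero]
  simp_rw [e1]
  have hintg' : ∀ i, Integrable ((S i).indicator (f i)) (μ i) := fun i => (hintg i).indicator (hS i)
  have hnn : ∀ i y, 0 ≤ (S i).indicator (f i) y := fun i y =>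
    Set.indicator_nonneg (fun y _ => hf0 i y) y
  rw [← ofReal_integral_eq_lintegral_ofReal (Integrable.fintype_prod hintg')
    (ae_of_all _ fun y => Finset.prod_nonneg fun i _ => hnn i _),
    integral_fintype_prod_eq_prod, ENNReal.ofReal_prod_of_nonneg
      (fun i _ => integral_nonneg (hnn i))]
  refine Finset.prod_congr rfl fun i _ => ?_
  rw [ofReal_integral_eq_lintegral_ofReal (hintg' i) (ae_of_all _ (hnn i)), ← h i,
    withDensity_apply _ (hS i), ← lintegral_indicator (hS i)]
  refine lintegral_congr fun y => ?_
  by_cases hy : y ∈ S i <;> simp [hy]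

/-- The centred Gaussian measure on `ι → ℝ` with independent entries of variance `s`. -/
noncomputable def gaussPi (ι : Type*) [Fintype ι] (s : ℝ≥0) : Measure (ι → ℝ) :=
  Measure.pi fun _ : ι => gaussianReal 0 s

instance (ι : Type*) [Fintype ι] (s : ℝ≥0) : IsProbabilityMeasure (gaussPi ι s) := by
  unfold gaussPi; infer_instance

/-- The density of the Gaussian measure shifted by `s • x` with respect to `gaussPi ι s`. -/
noncomputable def expTilt {ι : Type*} [Fintype ι] (s : ℝ) (x y : ι → ℝ) : ℝ :=
  exp (x ⬝ᵥ y - s / 2 * (x ⬝ᵥ x))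

section
variable {ι : Type*} [Fintype ι]

lemma expTilt_pos (s : ℝ) (x y : ι → ℝ) : 0 < expTilt s x y := exp_pos _

@[fun_prop]
lemma measurable_dotProduct_right (x : ι → ℝ) : Measurable fun y : ι → ℝ => x ⬝ᵥ y := by
  unfold dotProduct; fun_prop

lemma measurable_expTilt (s : ℝ) (x : ι → ℝ) : Measurable (expTilt s x) := by
  unfold expTilt; fun_prop

lemma expTilt_eq_prod (s : ℝ) (x y : ι → ℝ) :
    expTilt s x y = ∏ i, exp (x i * y i - s / 2 * (x i * x i)) := by
  rw [expTilt, ← Real.exp_sum, Finset.sum_sub_distrib, ← Finset.mul_sum]; rfl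

lemma gaussPi_withDensity_expTilt (s : ℝ≥0) (x : ι → ℝ) :
    (gaussPi ι s).withDensity (fun y => ENNReal.ofReal (expTilt s x y)) =
      Measure.pi fun i => gaussianReal (s * x i) s := by
  simp_rw [expTilt_eq_prod]
  exact pi_withDensity_ofReal (f := fun i y => exp (x i * y - s / 2 * (x i * x i)))
    (fun i => by fun_prop) (fun i y => (exp_pos _).le)
    (fun i => gaussianReal_withDensity_exp s (x i))

lemma gaussPi_map_add_const (s : ℝ≥0) (x : ι → ℝ) :
    (gaussPi ι s).map (fun y => y + (s : ℝ) • x) = Measure.pi fun i => gaussianReal (s * x i) s := by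
  have := Measure.pi_map_pi (μ := fun _ : ι => gaussianReal 0 s)
    (f := fun i y => y + (s : ℝ) * x i) (hμ := fun i => by
      rw [gaussianReal_map_add_const]; infer_instance) (fun i => by fun_prop)
  simp only [gaussianReal_map_add_const, zero_add] at this
  exact this

lemma lintegral_mul_expTilt (s : ℝ≥0) (x : ι → ℝ) {F : (ι → ℝ) → ℝ≥0∞} (hF : Measurable F) :
    ∫⁻ y, ENNReal.ofReal (expTilt s x y) * F y ∂gaussPi ι s =
      ∫⁻ y, F (y + (s : ℝ) • x) ∂gaussPi ι s := by
  have h : Measurable fun y : ι → ℝ => y + (s : ℝ) • x := by fun_prop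
  rw [← lintegral_map hF h, gaussPi_map_add_const, ← gaussPi_withDensity_expTilt,
    lintegral_withDensity_eq_lintegral_mul _ (measurable_expTilt _ x).ennreal_ofReal hF]
  rfl

lemma integral_expTilt_mul (s : ℝ≥0) (x : ι → ℝ) (F : (ι → ℝ) → ℝ) :
    ∫ y, expTilt s x y * F y ∂gaussPi ι s =
      ∫ y, F y ∂(Measure.pi fun i => gaussianReal (s * x i) s) := by
  rw [← gaussPi_withDensity_expTilt, integral_withDensity_eq_integral_toReal_smul
    (measurable_expTilt _ x).ennreal_ofReal (ae_of_all _ fun _ => ENNReal.ofReal_lt_top)]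
  refine integral_congr_ae (ae_of_all _ fun y => ?_)
  simp [ENNReal.toReal_ofReal (expTilt_pos _ _ _).le]

lemma integrable_expTilt_mul_iff (s : ℝ≥0) (x : ι → ℝ) (F : (ι → ℝ) → ℝ) :
    Integrable (fun y => expTilt s x y * F y) (gaussPi ι s) ↔
      Integrable F (Measure.pi fun i => gaussianReal (s * x i) s) := by
  rw [← gaussPi_withDensity_expTilt, integrable_withDensity_iff_integrable_smul'
    (measurable_expTilt _ x).ennreal_ofReal (ae_of_all _ fun _ => ENNReal.ofReal_lt_top)]
  refine integrable_congr (ae_of_all _ fun y => ?_)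
  simp [ENNReal.toReal_ofReal (expTilt_pos _ _ _).le]

lemma integrable_expTilt (s : ℝ≥0) (x : ι → ℝ) : Integrable (expTilt s x) (gaussPi ι s) := by
  simpa using (integrable_expTilt_mul_iff s x 1).2 (integrable_const 1)

lemma integral_expTilt (s : ℝ≥0) (x : ι → ℝ) : ∫ y, expTilt s x y ∂gaussPi ι s = 1 := by
  simpa using integral_expTilt_mul s x 1

lemma integrable_exp_dotProduct (s : ℝ≥0) (x : ι → ℝ) :
    Integrable (fun y => exp (x ⬝ᵥ y)) (gaussPi ι s) := by
  refine ((integrable_expTilt s x).const_mul (exp (s / 2 * (x ⬝ᵥ x)))).congr (ae_of_all _ fun y => ?_)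
  simp [expTilt, ← Real.exp_add]

lemma integrable_comp_eval_pi {μ : ι → Measure ℝ} [∀ i, IsProbabilityMeasure (μ i)] (i : ι)
    {f : ℝ → ℝ} (hf : Integrable f (μ i)) : Integrable (fun y => f (y i)) (Measure.pi μ) :=
  (measurePreserving_eval μ i).integrable_comp_of_integrable hf

lemma integral_comp_eval_pi {μ : ι → Measure ℝ} [∀ i, IsProbabilityMeasure (μ i)] (i : ι)
    {f : ℝ → ℝ} (hf : AEStronglyMeasurable f (μ i)) :
    ∫ y, f (y i) ∂(Measure.pi μ) = ∫ t, f t ∂(μ i) := by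
  have h := (measurePreserving_eval μ i).map_eq
  rw [← h, integral_map (measurable_pi_apply i).aemeasurable (by rwa [h])]

lemma integrable_sq_gaussianReal (m : ℝ) (s : ℝ≥0) :
    Integrable (fun y => y * y) (gaussianReal m s) := by
  simpa [sq] using (memLp_id_gaussianReal (μ := m) (v := s) 2).integrable_sq

lemma integral_sq_gaussianReal (m : ℝ) (s : ℝ≥0) :
    ∫ y, y * y ∂gaussianReal m s = s + m * m := by
  have h := variance_eq_sub (memLp_id_gaussianReal (μ := m) (v := s) 2)
  rw [variance_id_gaussianReal] at h
  simp only [integral_id_gaussianReal, id, Pi.pow_apply] at h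
  simp only [← sq]
  linarith

lemma integrable_id_gaussianReal' (m : ℝ) (s : ℝ≥0) :
    Integrable (fun y => y) (gaussianReal m s) := by
  exact (memLp_id_gaussianReal (μ := m) (v := s) 1).integrable le_rfl

lemma integrable_expTilt_mul_dotProduct (s : ℝ≥0) (x a : ι → ℝ) :
    Integrable (fun y => expTilt s x y * (a ⬝ᵥ y)) (gaussPi ι s) := by
  rw [integrable_expTilt_mul_iff]
  unfold dotProduct
  exact integrable_finsetSum _ fun i _ =>
    (integrable_comp_eval_pi (μ := fun i => gaussianReal (s * x i) s) (f := fun t => t) i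
      (integrable_id_gaussianReal' (s * x i) s)).const_mul (a i)

lemma integral_expTilt_mul_dotProduct (s : ℝ≥0) (x a : ι → ℝ) :
    ∫ y, expTilt s x y * (a ⬝ᵥ y) ∂gaussPi ι s = s * (a ⬝ᵥ x) := by
  rw [integral_expTilt_mul]
  unfold dotProduct
  rw [integral_finsetSum _ fun i _ =>
    (integrable_comp_eval_pi (μ := fun i => gaussianReal (s * x i) s) (f := fun t => t) i
      (integrable_id_gaussianReal' (s * x i) s)).const_mul (a i),
    Finset.mul_sum]
  refine Finset.sum_congr rfl fun i _ => ?_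
  rw [integral_const_mul, integral_comp_eval_pi (μ := fun i => gaussianReal (s * x i) s) i
    (f := fun t => t) (by fun_prop), integral_id_gaussianReal]
  ring

lemma integrable_expTilt_mul_normSq (s : ℝ≥0) (x : ι → ℝ) :
    Integrable (fun y => expTilt s x y * (y ⬝ᵥ y)) (gaussPi ι s) := by
  rw [integrable_expTilt_mul_iff]
  unfold dotProduct
  exact integrable_finsetSum _ fun i _ =>
    integrable_comp_eval_pi (μ := fun i => gaussianReal (s * x i) s) (f := fun t => t * t) i
      (integrable_sq_gaussianReal (s * x i) s)

lemma integral_expTilt_mul_normSq (s : ℝ≥0) (x : ι → ℝ) :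
    ∫ y, expTilt s x y * (y ⬝ᵥ y) ∂gaussPi ι s = s * Fintype.card ι + s ^ 2 * (x ⬝ᵥ x) := by
  rw [integral_expTilt_mul]
  unfold dotProduct
  rw [integral_finsetSum _ fun i _ =>
    integrable_comp_eval_pi (μ := fun i => gaussianReal (s * x i) s) (f := fun t => t * t) i
      (integrable_sq_gaussianReal (s * x i) s)]
  rw [Finset.sum_congr rfl fun i _ => integral_comp_eval_pi
    (μ := fun i => gaussianReal (s * x i) s) i (f := fun t => t * t) (by fun_prop)]
  simp only [integral_sq_gaussianReal, Finset.sum_add_distrib, Finset.sum_const, Finset.mul_sum,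
    Finset.card_univ, nsmul_eq_mul]
  rw [mul_comm]
  congr 1
  exact Finset.sum_congr rfl fun i _ => by ring

lemma gaussPi_add (s t : ℝ≥0) :
    ((gaussPi ι s).prod (gaussPi ι t)).map (fun p => p.1 + p.2) = gaussPi ι (s + t) := by
  have h1 := measurePreserving_arrowProdEquivProdArrow ℝ ℝ ι (fun _ => gaussianReal 0 s)
    (fun _ => gaussianReal 0 t)
  have h2 : ((gaussianReal 0 s).prod (gaussianReal 0 t)).map (fun p : ℝ × ℝ => p.1 + p.2) =
      gaussianReal 0 (s + t) := by
    have := gaussianReal_conv_gaussianReal (m₁ := 0) (m₂ := 0) (v₁ := s) (v₂ := t)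
    simpa [Measure.conv] using this
  have h3 := Measure.pi_map_pi (μ := fun _ : ι => (gaussianReal 0 s).prod (gaussianReal 0 t))
    (f := fun _ p => p.1 + p.2) (hμ := fun i => by rw [h2]; infer_instance)
    (fun i => by fun_prop)
  simp only [h2] at h3
  unfold gaussPi
  rw [← h1.map_eq, Measure.map_map (by fun_prop) h1.measurable, ← h3]
  rfl

lemma expTilt_add (s t : ℝ) (x y w : ι → ℝ) :
    expTilt (s + t) x (y + w) = expTilt s x y * expTilt t x w := by
  rw [expTilt, expTilt, expTilt, ← Real.exp_add, dotProduct_add]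
  congr 1
  ring

lemma integrable_comp_add_gaussPi {s t : ℝ≥0} {F : (ι → ℝ) → ℝ}
    (hF : Integrable F (gaussPi ι (s + t))) :
    Integrable (fun p : (ι → ℝ) × (ι → ℝ) => F (p.1 + p.2)) ((gaussPi ι s).prod (gaussPi ι t)) := by
  rw [← gaussPi_add] at hF
  exact hF.comp_measurable (by fun_prop)

lemma integral_gaussPi_add {s t : ℝ≥0} {F : (ι → ℝ) → ℝ}
    (hF : Integrable F (gaussPi ι (s + t))) :
    ∫ y, F y ∂gaussPi ι (s + t) = ∫ y, ∫ w, F (y + w) ∂gaussPi ι t ∂gaussPi ι s := by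
  have h := integrable_comp_add_gaussPi hF
  rw [← integral_prod _ h, ← gaussPi_add, integral_map (by fun_prop)]
  rw [gaussPi_add]
  exact hF.aestronglyMeasurable

end

lemma mul_log_sub_mul_log_ge {p q : ℝ} (hp : 0 < p) (hq : 0 < q) (g : ℝ) :
    p * g + p - q * exp g ≤ p * log p - p * log q := by
  have h := Real.log_le_sub_one_of_pos (x := q * exp g / p) (by positivity)
  rw [Real.log_div (by positivity) hp.ne', Real.log_mul hq.ne' (exp_pos _).ne', Real.log_exp] at h
  have h2 := mul_le_mul_of_nonneg_left h hp.le
  have h3 : p * (q * exp g / p - 1) = q * exp g - p := by field_simp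
  rw [h3] at h2
  linarith

lemma mul_log_ge {p : ℝ} (hp : 0 < p) (g : ℝ) : p * g + p - exp g ≤ p * log p := by
  simpa using mul_log_sub_mul_log_ge hp one_pos g

/-- Hoeffding's lemma in the form of a bound on `∫ exp f`. -/
lemma integral_exp_le_of_mem_Icc {Ω : Type*} [MeasurableSpace Ω] {μ : Measure Ω}
    [IsProbabilityMeasure μ] {f : Ω → ℝ} {l u : ℝ} (hf : AEMeasurable f μ)
    (hb : ∀ᵐ ω ∂μ, f ω ∈ Set.Icc l u) :
    ∫ ω, exp (f ω) ∂μ ≤ exp (∫ ω, f ω ∂μ + (u - l) ^ 2 / 8) := by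
  have h := (hasSubgaussianMGF_of_mem_Icc hf hb).mgf_le 1
  simp only [mgf, one_mul] at h
  have e : ∀ ω, exp (f ω) = exp (∫ ω, f ω ∂μ) * exp (f ω - ∫ ω, f ω ∂μ) := fun ω => by
    rw [← Real.exp_add]; congr 1; ring
  simp_rw [e]
  rw [integral_const_mul, Real.exp_add]
  refine mul_le_mul_of_nonneg_left (h.trans (le_of_eq ?_)) (exp_pos _).le
  congr 1
  push_cast
  rw [Real.norm_eq_abs, div_pow, sq_abs]
  ring

lemma sum_mul_exp_le_of_mem_Icc {α : Type*} {X : Finset α} {w f : α → ℝ} {l u : ℝ}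
    (hw : ∀ x ∈ X, 0 ≤ w x) (hsum : ∑ x ∈ X, w x = 1) (hf : ∀ x ∈ X, f x ∈ Set.Icc l u) :
    ∑ x ∈ X, w x * exp (f x) ≤ exp (∑ x ∈ X, w x * f x + (u - l) ^ 2 / 8) := by
  let _ : MeasurableSpace α := ⊤
  let μ : Measure α := ∑ x ∈ X, ENNReal.ofReal (w x) • Measure.dirac x
  have hμ : IsProbabilityMeasure μ := by
    constructor
    simp only [μ, Measure.coe_finsetSum, Finset.sum_apply, Measure.smul_apply, measure_univ,
      smul_eq_mul, mul_one]
    rw [← ENNReal.ofReal_sum_of_nonneg hw, hsum, ENNReal.ofReal_one]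
  have hintg : ∀ g : α → ℝ, ∫ x, g x ∂μ = ∑ x ∈ X, w x * g x := by
    intro g
    have hi : ∀ x ∈ X, Integrable g (ENNReal.ofReal (w x) • Measure.dirac x) := fun x _ =>
      (integrable_dirac (by simp [enorm_lt_top])).smul_measure ENNReal.ofReal_ne_top
    rw [integral_finsetSum_measure hi]
    refine Finset.sum_congr rfl fun x hx => ?_
    rw [integral_smul_measure, integral_dirac, ENNReal.toReal_ofReal (hw x hx), smul_eq_mul]
  have hae : ∀ᵐ x ∂μ, f x ∈ Set.Icc l u := by
    rw [ae_iff]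
    simp only [μ, Measure.coe_finsetSum, Finset.sum_apply, Measure.smul_apply, smul_eq_mul]
    refine Finset.sum_eq_zero fun x hx => ?_
    rw [Measure.dirac_apply' _ (by trivial), Set.indicator_of_notMem, mul_zero]
    simpa using hf x hx
  have := integral_exp_le_of_mem_Icc (μ := μ) (f := f) (Measurable.aemeasurable (by
    intro t _; trivial)) hae
  rwa [hintg, hintg] at this

section
variable {ι : Type*} [Fintype ι]

lemma dotProduct_self_nonneg' (x : ι → ℝ) : 0 ≤ x ⬝ᵥ x :=
  Finset.sum_nonneg fun i _ => mul_self_nonneg (x i)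

lemma dotProduct_sq_le (x y : ι → ℝ) : (x ⬝ᵥ y) ^ 2 ≤ (x ⬝ᵥ x) * (y ⬝ᵥ y) := by
  have := Finset.sum_mul_sq_le_sq_mul_sq Finset.univ x y
  simpa [dotProduct, sq] using this

lemma dotProduct_finsetSum {α : Type*} (X : Finset α) (v : ι → ℝ) (f : α → ι → ℝ) :
    v ⬝ᵥ (∑ x ∈ X, f x) = ∑ x ∈ X, v ⬝ᵥ f x := by
  simp only [dotProduct, Finset.sum_apply, Finset.mul_sum]
  exact Finset.sum_comm

/-- A transport-entropy inequality for the means of two measures on a bounded finite set. -/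
lemma sum_mul_normSq_sub_le {X : Finset (ι → ℝ)} (hX : X.Nonempty) {a e : (ι → ℝ) → ℝ} {A : ℝ}
    (hA : 0 < A) (ha : ∀ x ∈ X, 0 < a x) (he : ∀ x ∈ X, 0 < e x) (hXA : ∀ x ∈ X, x ⬝ᵥ x ≤ A)
    {b c xh : ι → ℝ} {Z ζ : ℝ} (hb : b = ∑ x ∈ X, a x • x) (hc : c = ∑ x ∈ X, (a x * e x) • x)
    (hZ : Z = ∑ x ∈ X, a x) (hζ : ζ = ∑ x ∈ X, a x * e x) (hxh : xh = Z⁻¹ • b) :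
    (c ⬝ᵥ c) / ζ - 2 * (xh ⬝ᵥ c) + ζ * (xh ⬝ᵥ xh) ≤
      2 * A * (∑ x ∈ X, a x * e x * log (e x) - ζ * log ζ + ζ * log Z) := by
  have hZ0 : 0 < Z := hZ ▸ Finset.sum_pos ha hX
  have hζ0 : 0 < ζ := hζ ▸ Finset.sum_pos (fun x hx => mul_pos (ha x hx) (he x hx)) hX
  set Δ : ι → ℝ := ζ⁻¹ • c - xh with hΔ
  set R := Δ ⬝ᵥ Δ with hR
  have hR0 : 0 ≤ R := dotProduct_self_nonneg' Δ
  have hL : (c ⬝ᵥ c) / ζ - 2 * (xh ⬝ᵥ c) + ζ * (xh ⬝ᵥ xh) = ζ * R := by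
    simp only [hR, hΔ, sub_dotProduct, dotProduct_sub, smul_dotProduct, dotProduct_smul,
      smul_eq_mul, dotProduct_comm c xh]
    field_simp
    ring
  rw [hL]
  set L := (Δ ⬝ᵥ xh) / A + R / (2 * A) with hLdef
  have hexp : ∑ x ∈ X, a x * exp ((Δ ⬝ᵥ x) / A) ≤ Z * exp L := by
    have hw : ∑ x ∈ X, a x / Z = 1 := by
      rw [← Finset.sum_div, ← hZ, div_self hZ0.ne']
    have hbd : ∀ x ∈ X, (Δ ⬝ᵥ x) / A ∈ Set.Icc (-(√(R / A))) (√(R / A)) := by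
      intro x hx
      rw [Set.mem_Icc, ← abs_le]
      apply Real.abs_le_sqrt
      rw [div_pow, div_le_div_iff₀ (by positivity) hA]
      have := (dotProduct_sq_le Δ x).trans (mul_le_mul_of_nonneg_left (hXA x hx) hR0)
      nlinarith
    have h := sum_mul_exp_le_of_mem_Icc (w := fun x => a x / Z) (f := fun x => (Δ ⬝ᵥ x) / A)
      (fun x hx => (div_pos (ha x hx) hZ0).le) hw hbd
    have e1 : ∑ x ∈ X, a x / Z * ((Δ ⬝ᵥ x) / A) = (Δ ⬝ᵥ xh) / A := by
      rw [hxh, hb, dotProduct_smul, dotProduct_finsetSum, smul_eq_mul, Finset.mul_sum,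
        Finset.sum_div]
      refine Finset.sum_congr rfl fun x _ => ?_
      rw [dotProduct_smul, smul_eq_mul]
      ring
    have e2 : (√(R / A) - -√(R / A)) ^ 2 / 8 = R / (2 * A) := by
      have := Real.sq_sqrt (div_nonneg hR0 hA.le)
      rw [show (√(R / A) - -√(R / A)) ^ 2 = 4 * √(R / A) ^ 2 by ring, this]
      field_simp
      ring
    rw [e1, e2] at h
    calc ∑ x ∈ X, a x * exp ((Δ ⬝ᵥ x) / A) = Z * ∑ x ∈ X, a x / Z * exp ((Δ ⬝ᵥ x) / A) := by
          rw [Finset.mul_sum]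
          exact Finset.sum_congr rfl fun x _ => by field_simp
      _ ≤ Z * exp L := mul_le_mul_of_nonneg_left h hZ0.le
  have hpt : ∀ x ∈ X, a x * e x * ((Δ ⬝ᵥ x) / A) + a x * e x * (log ζ - log Z - L + 1)
      - ζ / Z * exp (-L) * (a x * exp ((Δ ⬝ᵥ x) / A)) ≤ a x * e x * log (e x) := by
    intro x hx
    have h := mul_log_sub_mul_log_ge (mul_pos (ha x hx) (he x hx)) (ha x hx)
      ((Δ ⬝ᵥ x) / A - L + (log ζ - log Z))
    rw [Real.log_mul (ha x hx).ne' (he x hx).ne', Real.exp_add, Real.exp_sub, Real.exp_sub,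
      Real.exp_log hζ0, Real.exp_log hZ0] at h
    have e3 : a x * (exp ((Δ ⬝ᵥ x) / A) / exp L * (ζ / Z)) =
        ζ / Z * exp (-L) * (a x * exp ((Δ ⬝ᵥ x) / A)) := by
      rw [Real.exp_neg]; ring
    rw [e3] at h
    linarith
  have hs := Finset.sum_le_sum hpt
  rw [Finset.sum_sub_distrib, Finset.sum_add_distrib, ← Finset.sum_mul, ← Finset.mul_sum, ← hζ] at hs
  have e4 : ∑ x ∈ X, a x * e x * ((Δ ⬝ᵥ x) / A) = (Δ ⬝ᵥ c) / A := by
    rw [hc, dotProduct_finsetSum, Finset.sum_div]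
    refine Finset.sum_congr rfl fun x _ => ?_
    rw [dotProduct_smul, smul_eq_mul]
    ring
  rw [e4] at hs
  have e5 : ζ / Z * exp (-L) * ∑ x ∈ X, a x * exp ((Δ ⬝ᵥ x) / A) ≤ ζ := by
    calc _ ≤ ζ / Z * exp (-L) * (Z * exp L) := mul_le_mul_of_nonneg_left hexp (by positivity)
      _ = ζ := by rw [Real.exp_neg]; field_simp
  have e6 : (Δ ⬝ᵥ c) = ζ * (R + Δ ⬝ᵥ xh) := by
    have : ζ⁻¹ • c = Δ + xh := by rw [hΔ]; abel
    have h2 : c = ζ • (Δ + xh) := by rw [← this, smul_smul, mul_inv_cancel₀ hζ0.ne', one_smul]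
    rw [h2, dotProduct_smul, dotProduct_add, smul_eq_mul]
  rw [e6] at hs
  have e7 : ζ * (R + Δ ⬝ᵥ xh) / A - ζ * L = ζ * R / (2 * A) := by
    rw [hLdef]; field_simp; ring
  have e8 : ζ * R / (2 * A) ≤ ∑ x ∈ X, a x * e x * log (e x) - ζ * log ζ + ζ * log Z := by
    linarith
  rw [div_le_iff₀ (by positivity)] at e8
  linarith

end

section
variable {ι : Type*} [Fintype ι]

/-- The mixture of the densities `expTilt s x`, `x ∈ X`, with weights `a`. -/
noncomputable def mixZ (X : Finset (ι → ℝ)) (a : (ι → ℝ) → ℝ) (s : ℝ) (y : ι → ℝ) : ℝ :=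
  ∑ x ∈ X, a x * expTilt s x y

/-- The mixture of the vectors `expTilt s x y • x`, `x ∈ X`, with weights `a`. -/
noncomputable def mixB (X : Finset (ι → ℝ)) (a : (ι → ℝ) → ℝ) (s : ℝ) (y : ι → ℝ) : ι → ℝ :=
  ∑ x ∈ X, (a x * expTilt s x y) • x

variable {X : Finset (ι → ℝ)} {a : (ι → ℝ) → ℝ}

lemma mixZ_pos (hX : X.Nonempty) (ha : ∀ x ∈ X, 0 < a x) (s : ℝ) (y : ι → ℝ) :
    0 < mixZ X a s y :=
  Finset.sum_pos (fun x hx => mul_pos (ha x hx) (expTilt_pos _ _ _)) hX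

lemma measurable_mixZ (X : Finset (ι → ℝ)) (a : (ι → ℝ) → ℝ) (s : ℝ) :
    Measurable (mixZ X a s) := by
  unfold mixZ
  exact Finset.measurable_fun_sum _ fun x _ => (measurable_expTilt s x).const_mul _

lemma measurable_mixB (X : Finset (ι → ℝ)) (a : (ι → ℝ) → ℝ) (s : ℝ) :
    Measurable (mixB X a s) := by
  unfold mixB
  exact Finset.measurable_fun_sum _ fun x _ =>
    ((measurable_expTilt s x).const_mul _).smul_const x

lemma measurable_mixB_dotProduct_self (X : Finset (ι → ℝ)) (a : (ι → ℝ) → ℝ) (s : ℝ) :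
    Measurable fun y => mixB X a s y ⬝ᵥ mixB X a s y := by
  have := measurable_mixB X a s
  unfold dotProduct
  fun_prop

lemma integrable_mixZ (s : ℝ≥0) : Integrable (mixZ X a s) (gaussPi ι s) := by
  unfold mixZ
  exact integrable_finsetSum _ fun x _ => (integrable_expTilt s x).const_mul _

lemma integral_mixZ (s : ℝ≥0) : ∫ y, mixZ X a s y ∂gaussPi ι s = ∑ x ∈ X, a x := by
  unfold mixZ
  rw [integral_finsetSum _ fun x _ => (integrable_expTilt s x).const_mul _]
  simp [integral_const_mul, integral_expTilt]

lemma memLp_mixZ (s : ℝ≥0) : MemLp (mixZ X a s) 2 (gaussPi ι s) := by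
  unfold mixZ
  refine memLp_finsetSum _ fun x _ => MemLp.const_mul ?_ _
  rw [memLp_two_iff_integrable_sq (measurable_expTilt _ x).aestronglyMeasurable]
  refine ((integrable_exp_dotProduct s ((2 : ℝ) • x)).const_mul (exp (-(s * (x ⬝ᵥ x))))).congr
    (ae_of_all _ fun y => ?_)
  simp only [expTilt, sq, ← Real.exp_add, smul_dotProduct, smul_eq_mul]
  congr 1
  ring

lemma abs_mul_log_le {z : ℝ} (hz : 0 < z) : |z * log z| ≤ z ^ 2 + 1 := by
  have h1 := Real.log_le_sub_one_of_pos hz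
  have h2 := mul_log_ge hz 0
  rw [abs_le]
  simp at h2
  constructor <;> nlinarith

lemma integrable_mixZ_mul_log (hX : X.Nonempty) (ha : ∀ x ∈ X, 0 < a x) (s : ℝ≥0) :
    Integrable (fun y => mixZ X a s y * log (mixZ X a s y)) (gaussPi ι s) := by
  have hm := measurable_mixZ X a s
  refine Integrable.mono' (((memLp_mixZ (X := X) (a := a) s).integrable_sq).add (integrable_const 1))
    (hm.mul hm.log).aestronglyMeasurable (ae_of_all _ fun y => ?_)
  exact abs_mul_log_le (mixZ_pos hX ha s y)

lemma normSq_sum_smul_div_le {p : (ι → ℝ) → ℝ} (hp : ∀ x ∈ X, 0 ≤ p x)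
    (hζ : 0 < ∑ x ∈ X, p x) :
    ((∑ x ∈ X, p x • x) ⬝ᵥ (∑ x ∈ X, p x • x)) / (∑ x ∈ X, p x) ≤ ∑ x ∈ X, p x * (x ⬝ᵥ x) := by
  set c := ∑ x ∈ X, p x • x with hc
  set ζ := ∑ x ∈ X, p x with hζdef
  have h : 0 ≤ ∑ x ∈ X, p x * ((x - ζ⁻¹ • c) ⬝ᵥ (x - ζ⁻¹ • c)) :=
    Finset.sum_nonneg fun x hx => mul_nonneg (hp x hx) (dotProduct_self_nonneg' _)
  have e : ∑ x ∈ X, p x * ((x - ζ⁻¹ • c) ⬝ᵥ (x - ζ⁻¹ • c)) =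
      ∑ x ∈ X, p x * (x ⬝ᵥ x) - (c ⬝ᵥ c) / ζ := by
    have e1 : ∀ x ∈ X, p x * ((x - ζ⁻¹ • c) ⬝ᵥ (x - ζ⁻¹ • c)) =
        p x * (x ⬝ᵥ x) - 2 * ζ⁻¹ * (c ⬝ᵥ (p x • x)) + p x * (ζ⁻¹ ^ 2 * (c ⬝ᵥ c)) := by
      intro x _
      simp only [sub_dotProduct, dotProduct_sub, smul_dotProduct, dotProduct_smul, smul_eq_mul,
        dotProduct_comm x c]
      ring
    rw [Finset.sum_congr rfl e1, Finset.sum_add_distrib, Finset.sum_sub_distrib, ← Finset.mul_sum,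
      ← Finset.sum_mul, ← dotProduct_finsetSum, ← hc, ← hζdef]
    field_simp
    ring
  rw [e] at h
  linarith

lemma mixB_div_le (hX : X.Nonempty) (ha : ∀ x ∈ X, 0 < a x) (s : ℝ) (y : ι → ℝ) :
    (mixB X a s y ⬝ᵥ mixB X a s y) / mixZ X a s y ≤
      ∑ x ∈ X, a x * expTilt s x y * (x ⬝ᵥ x) :=
  normSq_sum_smul_div_le (fun x hx => (mul_pos (ha x hx) (expTilt_pos _ _ _)).le)
    (mixZ_pos hX ha s y)

lemma mixB_div_nonneg (hX : X.Nonempty) (ha : ∀ x ∈ X, 0 < a x) (s : ℝ) (y : ι → ℝ) :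
    0 ≤ (mixB X a s y ⬝ᵥ mixB X a s y) / mixZ X a s y :=
  div_nonneg (dotProduct_self_nonneg' _) (mixZ_pos hX ha s y).le

lemma integrable_sum_expTilt_mul (s : ℝ≥0) (f : (ι → ℝ) → ℝ) :
    Integrable (fun y => ∑ x ∈ X, a x * expTilt s x y * f x) (gaussPi ι s) :=
  integrable_finsetSum _ fun x _ => ((integrable_expTilt s x).const_mul _).mul_const _

lemma integral_sum_expTilt_mul (s : ℝ≥0) (f : (ι → ℝ) → ℝ) :
    ∫ y, ∑ x ∈ X, a x * expTilt s x y * f x ∂gaussPi ι s = ∑ x ∈ X, a x * f x := by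
  rw [integral_finsetSum _ fun x _ => ((integrable_expTilt s x).const_mul _).mul_const _]
  simp [integral_const_mul, integral_mul_const, integral_expTilt]

lemma integrable_mixB_div (hX : X.Nonempty) (ha : ∀ x ∈ X, 0 < a x) (s : ℝ≥0) :
    Integrable (fun y => (mixB X a s y ⬝ᵥ mixB X a s y) / mixZ X a s y) (gaussPi ι s) := by
  refine Integrable.mono' (integrable_sum_expTilt_mul (X := X) (a := a) s fun x => x ⬝ᵥ x)
    ((measurable_mixB_dotProduct_self X a s).div (measurable_mixZ X a s)).aestronglyMeasurable
    (ae_of_all _ fun y => ?_)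
  rw [Real.norm_of_nonneg (mixB_div_nonneg hX ha s y)]
  exact mixB_div_le hX ha s y

lemma dotProduct_mixB (s : ℝ) (v y : ι → ℝ) :
    v ⬝ᵥ mixB X a s y = ∑ x ∈ X, a x * expTilt s x y * (v ⬝ᵥ x) := by
  rw [mixB, dotProduct_finsetSum]
  simp

lemma integrable_mixZ_mul_dotProduct (s : ℝ≥0) (v : ι → ℝ) :
    Integrable (fun y => mixZ X a s y * (v ⬝ᵥ y)) (gaussPi ι s) := by
  unfold mixZ
  simp_rw [Finset.sum_mul, mul_assoc]
  exact integrable_finsetSum _ fun x _ => (integrable_expTilt_mul_dotProduct s x v).const_mul _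

lemma integral_mixZ_mul_dotProduct (s : ℝ≥0) (v : ι → ℝ) :
    ∫ y, mixZ X a s y * (v ⬝ᵥ y) ∂gaussPi ι s = s * (v ⬝ᵥ ∑ x ∈ X, a x • x) := by
  unfold mixZ
  simp_rw [Finset.sum_mul, mul_assoc]
  rw [integral_finsetSum _ fun x _ => (integrable_expTilt_mul_dotProduct s x v).const_mul _,
    dotProduct_finsetSum, Finset.mul_sum]
  refine Finset.sum_congr rfl fun x _ => ?_
  rw [integral_const_mul, integral_expTilt_mul_dotProduct, dotProduct_smul, smul_eq_mul]
  ring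

lemma mixZ_mul_log_integral_ge (hX : X.Nonempty) (ha : ∀ x ∈ X, 0 < a x) (δ : ℝ≥0) {Z : ℝ}
    {b : ι → ℝ} (hZ : Z = ∑ x ∈ X, a x) (hb : b = ∑ x ∈ X, a x • x) :
    Z * log Z + δ / 2 * ((b ⬝ᵥ b) / Z) ≤
      ∫ w, mixZ X a δ w * log (mixZ X a δ w) ∂gaussPi ι δ := by
  have hZ0 : 0 < Z := hZ ▸ Finset.sum_pos ha hX
  set v := Z⁻¹ • b with hv
  have hpt : ∀ w, mixZ X a δ w * (log Z - δ / 2 * (v ⬝ᵥ v) + 1) + mixZ X a δ w * (v ⬝ᵥ w)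
      - Z * expTilt δ v w ≤ mixZ X a δ w * log (mixZ X a δ w) := by
    intro w
    have h := mul_log_sub_mul_log_ge (mixZ_pos hX ha δ w) hZ0 (v ⬝ᵥ w - δ / 2 * (v ⬝ᵥ v))
    simp only [expTilt]
    linarith
  have hi1 := (integrable_mixZ (X := X) (a := a) δ).mul_const (log Z - δ / 2 * (v ⬝ᵥ v) + 1)
  have hi2 := integrable_mixZ_mul_dotProduct (X := X) (a := a) δ v
  have hi3 := (integrable_expTilt δ v).const_mul Z
  have h := integral_mono ((hi1.add hi2).sub hi3) (integrable_mixZ_mul_log hX ha δ) hpt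
  simp only [Pi.sub_apply, Pi.add_apply] at h
  rw [integral_sub (f := fun w => _ + _) (hi1.add hi2) hi3, integral_add hi1 hi2, integral_mul_const, integral_const_mul,
    integral_mixZ, integral_mixZ_mul_dotProduct, integral_expTilt, ← hZ, ← hb] at h
  have e : v ⬝ᵥ b = (b ⬝ᵥ b) / Z := by
    rw [hv, smul_dotProduct, smul_eq_mul]; ring
  have e2 : Z * (v ⬝ᵥ v) = (b ⬝ᵥ b) / Z := by
    rw [hv, smul_dotProduct, dotProduct_smul, smul_eq_mul, smul_eq_mul]; field_simp
  rw [e] at h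
  nlinarith

lemma mixB_div_integral_le (hX : X.Nonempty) (ha : ∀ x ∈ X, 0 < a x) {A : ℝ} (hA : 0 < A)
    (hXA : ∀ x ∈ X, x ⬝ᵥ x ≤ A) (δ : ℝ≥0) {Z : ℝ}
    {b : ι → ℝ} (hZ : Z = ∑ x ∈ X, a x) (hb : b = ∑ x ∈ X, a x • x) :
    ∫ w, (mixB X a δ w ⬝ᵥ mixB X a δ w) / mixZ X a δ w ∂gaussPi ι δ ≤
      (b ⬝ᵥ b) / Z + A * δ * (∑ x ∈ X, a x * (x ⬝ᵥ x) - (b ⬝ᵥ b) / Z) := by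
  have hZ0 : 0 < Z := hZ ▸ Finset.sum_pos ha hX
  set v := Z⁻¹ • b with hv
  have hlog : ∀ x w : ι → ℝ, a x * expTilt δ x w * log (expTilt δ x w) =
      a x * (expTilt δ x w * (x ⬝ᵥ w)) - a x * expTilt δ x w * (δ / 2 * (x ⬝ᵥ x)) := by
    intro x w
    conv_lhs => rw [expTilt, Real.log_exp]
    rw [expTilt]
    ring
  have hj : ∀ x, Integrable (fun w => a x * (expTilt δ x w * (x ⬝ᵥ w))) (gaussPi ι δ) := fun x =>
    (integrable_expTilt_mul_dotProduct δ x x).const_mul _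
  have hj' : ∀ x, Integrable (fun w => a x * expTilt δ x w * (δ / 2 * (x ⬝ᵥ x))) (gaussPi ι δ) :=
    fun x => ((integrable_expTilt δ x).const_mul _).mul_const _
  have hl : ∀ x, Integrable (fun w => a x * expTilt δ x w * log (expTilt δ x w))
      (gaussPi ι δ) := by
    intro x
    simp_rw [hlog]
    exact (hj x).sub (hj' x)
  have hlI : ∀ x, ∫ w, a x * expTilt δ x w * log (expTilt δ x w) ∂gaussPi ι δ =
      δ / 2 * (a x * (x ⬝ᵥ x)) := by
    intro x
    simp_rw [hlog]
    rw [integral_sub (hj x) (hj' x), integral_const_mul, integral_mul_const, integral_const_mul,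
      integral_expTilt_mul_dotProduct, integral_expTilt]
    ring
  have hpt := fun w => sum_mul_normSq_sub_le hX hA ha (fun x _ => expTilt_pos δ x w) hXA hb
    (rfl : mixB X a δ w = _) hZ (rfl : mixZ X a δ w = _) hv
  have i1 := integrable_mixB_div hX ha δ
  have i2 : Integrable (fun w => 2 * (v ⬝ᵥ mixB X a δ w)) (gaussPi ι δ) := by
    simp_rw [dotProduct_mixB]
    exact (integrable_sum_expTilt_mul δ _).const_mul 2
  have i3 := (integrable_mixZ (X := X) (a := a) δ).mul_const (v ⬝ᵥ v)
  have i4 : Integrable (fun w => ∑ x ∈ X, a x * expTilt δ x w * log (expTilt δ x w))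
      (gaussPi ι δ) := integrable_finsetSum _ fun x _ => hl x
  have i5 := integrable_mixZ_mul_log hX ha δ
  have i6 := (integrable_mixZ (X := X) (a := a) δ).mul_const (log Z)
  have h := integral_mono ((i1.sub i2).add i3) (((i4.sub i5).add i6).const_mul (2 * A)) hpt
  simp only [Pi.add_apply, Pi.sub_apply] at h
  have l1 : ∫ w, 2 * (v ⬝ᵥ mixB X a δ w) ∂gaussPi ι δ = 2 * (v ⬝ᵥ b) := by
    simp_rw [dotProduct_mixB]
    rw [integral_const_mul, integral_sum_expTilt_mul, hb, dotProduct_finsetSum]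
    simp
  rw [integral_add (f := fun w => _ - _) (i1.sub i2) i3, integral_sub i1 i2, l1,
    integral_const_mul, integral_add (f := fun w => _ - _) (i4.sub i5) i6, integral_sub i4 i5,
    integral_mul_const, integral_mul_const, integral_mixZ,
    integral_finsetSum _ fun x _ => hl x, Finset.sum_congr rfl fun x _ => hlI x,
    ← Finset.mul_sum, ← hZ] at h
  have hΨ := mixZ_mul_log_integral_ge hX ha δ hZ hb
  have e : v ⬝ᵥ b = (b ⬝ᵥ b) / Z := by
    rw [hv, smul_dotProduct, smul_eq_mul]; ring
  have e2 : Z * (v ⬝ᵥ v) = (b ⬝ᵥ b) / Z := by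
    rw [hv, smul_dotProduct, dotProduct_smul, smul_eq_mul, smul_eq_mul]; field_simp
  rw [e, e2] at h
  have hΨ' := mul_le_mul_of_nonneg_left hΨ (by positivity : 0 ≤ 2 * A)
  linarith

end

section
variable {ι : Type*} [Fintype ι]

/-- The relative entropy of the mixture observed at signal-to-noise level `s` with respect to
pure noise. -/
noncomputable def mixEnt (X : Finset (ι → ℝ)) (a : (ι → ℝ) → ℝ) (s : ℝ≥0) : ℝ :=
  ∫ y, mixZ X a s y * log (mixZ X a s y) ∂gaussPi ι s

/-- The second moment of the posterior mean at signal-to-noise level `s`. -/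
noncomputable def postSq (X : Finset (ι → ℝ)) (a : (ι → ℝ) → ℝ) (s : ℝ≥0) : ℝ :=
  ∫ y, (mixB X a s y ⬝ᵥ mixB X a s y) / mixZ X a s y ∂gaussPi ι s

variable {X : Finset (ι → ℝ)} {a : (ι → ℝ) → ℝ}

lemma mixZ_add (s t : ℝ) (y w : ι → ℝ) :
    mixZ X a (s + t) (y + w) = mixZ X (fun x => a x * expTilt s x y) t w := by
  simp only [mixZ, expTilt_add, mul_assoc]

lemma mixB_add (s t : ℝ) (y w : ι → ℝ) :
    mixB X a (s + t) (y + w) = mixB X (fun x => a x * expTilt s x y) t w := by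
  simp only [mixB, expTilt_add, mul_assoc]

lemma postSq_nonneg (hX : X.Nonempty) (ha : ∀ x ∈ X, 0 < a x) (s : ℝ≥0) : 0 ≤ postSq X a s :=
  integral_nonneg fun y => mixB_div_nonneg hX ha s y

lemma postSq_le (hX : X.Nonempty) (ha : ∀ x ∈ X, 0 < a x) (s : ℝ≥0) :
    postSq X a s ≤ ∑ x ∈ X, a x * (x ⬝ᵥ x) := by
  rw [← integral_sum_expTilt_mul s]
  exact integral_mono (integrable_mixB_div hX ha s) (integrable_sum_expTilt_mul s _)
    fun y => mixB_div_le hX ha s y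

lemma mixEnt_add_ge (hX : X.Nonempty) (ha : ∀ x ∈ X, 0 < a x) (s δ : ℝ≥0) :
    mixEnt X a s + δ / 2 * postSq X a s ≤ mixEnt X a (s + δ) := by
  have hi := integrable_mixZ_mul_log hX ha (s + δ)
  have h1 := integrable_mixZ_mul_log hX ha s
  have h2 := (integrable_mixB_div hX ha s).const_mul ((δ : ℝ) / 2)
  unfold mixEnt postSq
  rw [integral_gaussPi_add hi, ← integral_const_mul, ← integral_add h1 h2]
  refine integral_mono (h1.add h2) (integrable_comp_add_gaussPi hi).integral_prod_left fun y => ?_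
  simp only [NNReal.coe_add, mixZ_add]
  exact mixZ_mul_log_integral_ge hX (fun x hx => mul_pos (ha x hx) (expTilt_pos s x y)) δ rfl rfl

lemma postSq_add_le (hX : X.Nonempty) (ha : ∀ x ∈ X, 0 < a x) {A : ℝ} (hA : 0 < A)
    (hXA : ∀ x ∈ X, x ⬝ᵥ x ≤ A) (s δ : ℝ≥0) :
    postSq X a (s + δ) ≤
      postSq X a s + A * δ * (∑ x ∈ X, a x * (x ⬝ᵥ x) - postSq X a s) := by
  have hi := integrable_mixB_div hX ha (s + δ)
  have h1 := integrable_mixB_div hX ha s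
  have h2 := ((integrable_sum_expTilt_mul (X := X) (a := a) s fun x => x ⬝ᵥ x).sub h1).const_mul
    (A * δ)
  simp only [Pi.sub_apply] at h2
  rw [← integral_sum_expTilt_mul s]
  unfold postSq
  rw [integral_gaussPi_add hi, ← integral_sub (integrable_sum_expTilt_mul s _) h1,
    ← integral_const_mul, ← integral_add h1 h2]
  refine integral_mono (integrable_comp_add_gaussPi hi).integral_prod_left (h1.add h2) fun y => ?_
  simp only [NNReal.coe_add, mixZ_add, mixB_add]
  exact mixB_div_integral_le hX (fun x hx => mul_pos (ha x hx) (expTilt_pos s x y)) hA hXA δ rfl rfl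

lemma mixEnt_add_nat_mul_ge (hX : X.Nonempty) (ha : ∀ x ∈ X, 0 < a x) {A S : ℝ} (hA : 0 < A)
    (hXA : ∀ x ∈ X, x ⬝ᵥ x ≤ A) (hS : S = ∑ x ∈ X, a x * (x ⬝ᵥ x)) (s δ : ℝ≥0) (n j : ℕ)
    (hj : j ≤ n) :
    mixEnt X a s + j * (δ / 2) * (postSq X a (s + n * δ) - A * S * (n * δ)) +
      A * S * δ ^ 2 / 4 * (j * (j - 1)) ≤ mixEnt X a (s + j * δ) := by
  induction j with
  | zero => simp
  | succ j ih =>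
    have h1 := ih (by omega)
    have h2 := mixEnt_add_ge hX ha (s + j * δ) δ
    obtain ⟨m, rfl⟩ := Nat.exists_eq_add_of_le (show j ≤ n by omega)
    have h3 := postSq_add_le hX ha hA hXA (s + j * δ) (m * δ)
    have h4 := postSq_nonneg hX ha (s + j * δ)
    rw [← hS] at h3
    have e1 : s + (j : ℝ≥0) * δ + m * δ = s + ((j + m : ℕ) : ℝ≥0) * δ := by push_cast; ring
    have e2 : s + (j : ℝ≥0) * δ + δ = s + ((j + 1 : ℕ) : ℝ≥0) * δ := by push_cast; ring
    rw [e1] at h3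
    rw [e2] at h2
    set V := postSq X a (s + ((j + m : ℕ) : ℝ≥0) * δ)
    push_cast at h1 h2 h3 ⊢
    have h5 : V - A * (m * δ) * S ≤ postSq X a (s + j * δ) := by
      have : 0 ≤ A * (m * δ) * postSq X a (s + j * δ) := by positivity
      linarith
    have h6 := mul_le_mul_of_nonneg_left h5 (by positivity : 0 ≤ (δ : ℝ) / 2)
    linarith

lemma mixEnt_add_ge_postSq_right (hX : X.Nonempty) (ha : ∀ x ∈ X, 0 < a x) {A S : ℝ}
    (hA : 0 < A) (hXA : ∀ x ∈ X, x ⬝ᵥ x ≤ A) (hS : S = ∑ x ∈ X, a x * (x ⬝ᵥ x)) (s h : ℝ≥0) :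
    mixEnt X a s + h / 2 * postSq X a (s + h) - A * S * h ^ 2 / 4 ≤ mixEnt X a (s + h) := by
  have hn : ∀ n : ℕ, mixEnt X a s + h / 2 * postSq X a (s + h) - A * S * h ^ 2 / 4
      - A * S * h ^ 2 / 4 * (1 / ((n : ℝ) + 1)) ≤ mixEnt X a (s + h) := by
    intro n
    have h1 := mixEnt_add_nat_mul_ge hX ha hA hXA hS s (h / (n + 1 : ℕ)) (n + 1) (n + 1) le_rfl
    have e : ((n + 1 : ℕ) : ℝ≥0) * (h / (n + 1 : ℕ)) = h := by
      rw [mul_div_cancel₀]; positivity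
    rw [e] at h1
    refine le_trans (le_of_eq ?_) h1
    push_cast
    have : (n : ℝ) + 1 ≠ 0 := by positivity
    field_simp
    ring
  have hlim := (tendsto_one_div_add_atTop_nhds_zero_nat (𝕜 := ℝ)).const_mul (A * S * h ^ 2 / 4)
  have hlim2 := hlim.const_sub (mixEnt X a s + h / 2 * postSq X a (s + h) - A * S * h ^ 2 / 4)
  rw [mul_zero, sub_zero] at hlim2
  exact le_of_tendsto' hlim2 hn

lemma postSq_ge (hX : X.Nonempty) (ha : ∀ x ∈ X, 0 < a x) (ha1 : ∑ x ∈ X, a x = 1)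
    [Nonempty ι] {S : ℝ} (hS : S = ∑ x ∈ X, a x * (x ⬝ᵥ x)) (s : ℝ≥0) :
    s * S ^ 2 / (Fintype.card ι + s * S) ≤ postSq X a s := by
  have hS0 : 0 ≤ S := hS ▸ Finset.sum_nonneg fun x hx =>
    mul_nonneg (ha x hx).le (dotProduct_self_nonneg' x)
  have hN : (0 : ℝ) < Fintype.card ι := by exact_mod_cast Fintype.card_pos
  set N : ℝ := (Fintype.card ι : ℝ)
  set c := S / (N + s * S) with hc
  have hpt : ∀ y, ∑ x ∈ X, 2 * c * (a x * (expTilt s x y * (x ⬝ᵥ y))) -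
      ∑ x ∈ X, c ^ 2 * (a x * (expTilt s x y * (y ⬝ᵥ y))) ≤
      (mixB X a s y ⬝ᵥ mixB X a s y) / mixZ X a s y := by
    intro y
    have hZ := mixZ_pos hX ha s y
    rw [le_div_iff₀ hZ, ← Finset.mul_sum, ← Finset.mul_sum]
    have e1 : ∑ x ∈ X, a x * (expTilt s x y * (x ⬝ᵥ y)) = y ⬝ᵥ mixB X a s y := by
      rw [dotProduct_mixB]
      exact Finset.sum_congr rfl fun x _ => by rw [dotProduct_comm y x]; ring
    have e2 : ∑ x ∈ X, a x * (expTilt s x y * (y ⬝ᵥ y)) = mixZ X a s y * (y ⬝ᵥ y) := by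
      rw [mixZ, Finset.sum_mul]
      exact Finset.sum_congr rfl fun x _ => by ring
    rw [e1, e2]
    have := dotProduct_self_nonneg' (mixB X a s y - (c * mixZ X a s y) • y)
    simp only [sub_dotProduct, dotProduct_sub, smul_dotProduct, dotProduct_smul, smul_eq_mul,
      dotProduct_comm _ y] at this
    linarith
  have i1 : ∀ x ∈ X, Integrable (fun y => 2 * c * (a x * (expTilt s x y * (x ⬝ᵥ y))))
      (gaussPi ι s) := fun x _ =>
    ((integrable_expTilt_mul_dotProduct s x x).const_mul _).const_mul _
  have i2 : ∀ x ∈ X, Integrable (fun y => c ^ 2 * (a x * (expTilt s x y * (y ⬝ᵥ y))))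
      (gaussPi ι s) := fun x _ =>
    ((integrable_expTilt_mul_normSq s x).const_mul _).const_mul _
  have h := integral_mono ((integrable_finsetSum X i1).sub (integrable_finsetSum X i2))
    (integrable_mixB_div hX ha s) hpt
  rw [integral_sub' (integrable_finsetSum X i1) (integrable_finsetSum X i2),
    integral_finsetSum _ i1, integral_finsetSum _ i2] at h
  simp only [integral_const_mul, integral_expTilt_mul_dotProduct, integral_expTilt_mul_normSq] at h
  refine le_trans (le_of_eq ?_) h
  have e3 : ∑ x ∈ X, 2 * c * (a x * (s * (x ⬝ᵥ x))) = 2 * c * s * S := by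
    rw [hS, Finset.mul_sum]; exact Finset.sum_congr rfl fun x _ => by ring
  have e4 : ∑ x ∈ X, c ^ 2 * (a x * (s * Fintype.card ι + s ^ 2 * (x ⬝ᵥ x))) =
      c ^ 2 * (s * N + s ^ 2 * S) := by
    rw [← Finset.mul_sum]
    congr 1
    simp_rw [mul_add]
    rw [Finset.sum_add_distrib, ← Finset.sum_mul, ha1, one_mul, hS, Finset.mul_sum]
    congr 1
    exact Finset.sum_congr rfl fun x _ => by ring
  rw [e3, e4, hc]
  have : N + s * S ≠ 0 := by positivity
  field_simp
  ring

lemma postSq_le_of_mean (hX : X.Nonempty) (ha : ∀ x ∈ X, 0 < a x) (ha1 : ∑ x ∈ X, a x = 1) {A : ℝ}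
    (hA : 0 < A) (hXA : ∀ x ∈ X, x ⬝ᵥ x ≤ A) (s : ℝ≥0) {b : ι → ℝ} (hb : b = ∑ x ∈ X, a x • x) :
    postSq X a s ≤ b ⬝ᵥ b + A * s * (∑ x ∈ X, a x * (x ⬝ᵥ x) - b ⬝ᵥ b) := by
  have := mixB_div_integral_le hX ha hA hXA s ha1.symm hb
  simpa [postSq] using this

end

/-- The density of `gaussianReal 0 (l * s)` with respect to `gaussianReal 0 s`. -/
noncomputable def scaleDens (l s y : ℝ) : ℝ := (√l)⁻¹ * exp ((1 - l⁻¹) / (2 * s) * (y * y))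

lemma scaleDens_nonneg (l s y : ℝ) : 0 ≤ scaleDens l s y := by unfold scaleDens; positivity

lemma measurable_scaleDens (l s : ℝ) : Measurable (scaleDens l s) := by
  unfold scaleDens; fun_prop

lemma gaussianReal_withDensity_scaleDens {l s : ℝ≥0} (hl : l ≠ 0) (hs : s ≠ 0) :
    (gaussianReal 0 s).withDensity (fun y => ENNReal.ofReal (scaleDens l s y)) =
      gaussianReal 0 (l * s) := by
  refine gaussianReal_withDensity_of_pdf_eq hs (mul_ne_zero hl hs) (measurable_scaleDens l s) ?_
  intro y
  have hs' : (s : ℝ) ≠ 0 := by exact_mod_cast hs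
  have hl' : (l : ℝ) ≠ 0 := by exact_mod_cast hl
  rw [gaussianPDFReal, gaussianPDFReal, scaleDens, mul_mul_mul_comm, ← Real.exp_add]
  push_cast
  rw [show 2 * π * ((l : ℝ) * s) = l * (2 * π * s) by ring, Real.sqrt_mul l.coe_nonneg, mul_inv,
    mul_comm (√(l : ℝ))⁻¹]
  congr 2
  field_simp
  ring

lemma integral_exp_neg_sq_gaussianReal (m : ℝ) {s ρ : ℝ≥0} (hs : s ≠ 0) (hρ : ρ ≠ 0) :
    ∫ y, exp (-(3 * y ^ 2 / (2 * s))) ∂gaussianReal m (ρ * s) =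
      exp (-(3 * m ^ 2 / (2 * s * (1 + 3 * ρ)))) / √(1 + 3 * ρ) := by
  rw [integral_gaussianReal_eq_integral_smul (mul_ne_zero hρ hs)]
  have hs' : (0 : ℝ) < s := by exact_mod_cast pos_iff_ne_zero.2 hs
  have hρ' : (0 : ℝ) < ρ := by exact_mod_cast pos_iff_ne_zero.2 hρ
  have hw : ρ * s / (1 + 3 * ρ) ≠ 0 := div_ne_zero (mul_ne_zero hρ hs) (by positivity)
  have e : ∀ y, gaussianPDFReal m (ρ * s) y • exp (-(3 * y ^ 2 / (2 * s))) =
      exp (-(3 * m ^ 2 / (2 * s * (1 + 3 * ρ)))) / √(1 + 3 * ρ) *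
        gaussianPDFReal (m / (1 + 3 * ρ)) (ρ * s / (1 + 3 * ρ)) y := by
    intro y
    simp only [gaussianPDFReal, smul_eq_mul]
    push_cast
    rw [show 2 * π * ((ρ : ℝ) * s / (1 + 3 * ρ)) = 2 * π * (ρ * s) / (1 + 3 * ρ) by ring,
      Real.sqrt_div (by positivity), inv_div]
    have h3 : √(1 + 3 * (ρ : ℝ)) ≠ 0 := (Real.sqrt_pos.2 (by positivity)).ne'
    have h4 : √(2 * π * ((ρ : ℝ) * s)) ≠ 0 := (Real.sqrt_pos.2 (by positivity)).ne'
    have e1 : ∀ a b c d p q : ℝ, p ≠ 0 → q ≠ 0 → exp a * exp b = exp c * exp d →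
        p⁻¹ * exp a * exp b = exp c / q * (q / p * exp d) := by
      intro a b c d p q hp hq hh
      field_simp
      exact hh
    refine e1 _ _ _ _ _ _ h4 h3 ?_
    rw [← Real.exp_add, ← Real.exp_add]
    congr 1
    field_simp
    ring
  simp_rw [e]
  rw [integral_const_mul, integral_gaussianPDFReal_eq_one _ hw, mul_one]

lemma integral_scaleDens_mul {l s : ℝ≥0} (hl : l ≠ 0) (hs : s ≠ 0) (f : ℝ → ℝ) :
    ∫ y, scaleDens l s y * f y ∂gaussianReal 0 s = ∫ y, f y ∂gaussianReal 0 (l * s) := by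
  rw [← gaussianReal_withDensity_scaleDens hl hs, integral_withDensity_eq_integral_toReal_smul
    (measurable_scaleDens _ _).ennreal_ofReal (ae_of_all _ fun _ => ENNReal.ofReal_lt_top)]
  refine integral_congr_ae (ae_of_all _ fun y => ?_)
  simp [ENNReal.toReal_ofReal (scaleDens_nonneg _ _ _)]

lemma integrable_scaleDens_mul_iff {l s : ℝ≥0} (hl : l ≠ 0) (hs : s ≠ 0) (f : ℝ → ℝ) :
    Integrable (fun y => scaleDens l s y * f y) (gaussianReal 0 s) ↔
      Integrable f (gaussianReal 0 (l * s)) := by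
  rw [← gaussianReal_withDensity_scaleDens hl hs, integrable_withDensity_iff_integrable_smul'
    (measurable_scaleDens _ _).ennreal_ofReal (ae_of_all _ fun _ => ENNReal.ofReal_lt_top)]
  refine integrable_congr (ae_of_all _ fun y => ?_)
  simp [ENNReal.toReal_ofReal (scaleDens_nonneg _ _ _)]

lemma exp_neg_sq_mem_Icc {s : ℝ≥0} (y : ℝ) : exp (-(3 * y ^ 2 / (2 * s))) ∈ Set.Icc (0 : ℝ) 1 :=
  ⟨(exp_pos _).le, by rw [Real.exp_le_one_iff, neg_nonpos]; positivity⟩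

section
variable {ι : Type*} [Fintype ι]
variable {X : Finset (ι → ℝ)} {a : (ι → ℝ) → ℝ}

lemma sum_exp_neg_sq_ge {k : ℕ} {x : ι → ℝ} (hx : (univ.filter fun i => x i ≠ 0).card = k)
    (c r : ℝ) :
    (Fintype.card ι : ℝ) - k + exp (-r) * (k * (1 + r) - c * (x ⬝ᵥ x)) ≤
      ∑ i, exp (-(c * x i ^ 2)) := by
  have h : ∀ i, (1 : ℝ) + (if x i ≠ 0 then exp (-r) * (1 + r) - 1 else 0)
      - exp (-r) * (c * (x i * x i)) ≤ exp (-(c * x i ^ 2)) := by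
    intro i
    split_ifs with hi
    · have h1 := Real.add_one_le_exp (r - c * x i ^ 2)
      have h2 : exp (-(c * x i ^ 2)) = exp (-r) * exp (r - c * x i ^ 2) := by
        rw [← Real.exp_add]; congr 1; ring
      rw [h2]
      have h3 := mul_le_mul_of_nonneg_left h1 (exp_pos (-r)).le
      linarith
    · push Not at hi
      simp [hi]
  have hs := Finset.sum_le_sum fun i (_ : i ∈ univ) => h i
  refine le_trans (le_of_eq ?_) hs
  rw [Finset.sum_sub_distrib, Finset.sum_add_distrib, ← Finset.sum_filter, Finset.sum_const,
    Finset.sum_const, hx, ← Finset.mul_sum, ← Finset.mul_sum, Finset.card_univ]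
  simp only [nsmul_eq_mul, dotProduct]
  ring

lemma mixEnt_ge (hX : X.Nonempty) (ha : ∀ x ∈ X, 0 < a x) (ha1 : ∑ x ∈ X, a x = 1) [Nonempty ι]
    {k : ℕ} (hk : ∀ x ∈ X, (univ.filter fun i => x i ≠ 0).card = k) {Sb : ℝ} (hSb : 0 ≤ Sb)
    (hS : ∑ x ∈ X, a x * (x ⬝ᵥ x) = k * Sb) {s : ℝ≥0} (hs : s ≠ 0) {v r : ℝ}
    (hv : v = k * Sb * s / Fintype.card ι) (hr : r = 3 / 8 * (s * Sb)) {θ : ℝ} (hθ : 0 ≤ θ) :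
    (Fintype.card ι : ℝ) / 2 * (v - log (1 + v)) +
      Fintype.card ι * (θ * (1 / 2 * (1 - k / Fintype.card ι * (1 - exp (-r))
        - 1 / √(1 + 3 * v / 4))) - θ ^ 2 / 8) ≤ mixEnt X a s := by
  have hs' : (0 : ℝ) < s := by exact_mod_cast pos_iff_ne_zero.2 hs
  have hN : (0 : ℝ) < Fintype.card ι := by exact_mod_cast Fintype.card_pos
  set N : ℝ := (Fintype.card ι : ℝ) with hNdef
  have hv0 : 0 ≤ v := by rw [hv]; positivity
  obtain ⟨l, hl⟩ : ∃ l : ℝ≥0, (l : ℝ) = 1 + v := ⟨⟨1 + v, by positivity⟩, rfl⟩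
  have hl0 : l ≠ 0 := by
    rintro rfl
    simp at hl
    linarith
  set b : ℝ → ℝ := fun y => exp (-(3 * y ^ 2 / (2 * s))) with hb
  have hbm : Measurable b := by fun_prop
  set B : ℝ := ∫ y, b y ∂gaussianReal 0 (l * s) with hB
  have hBval : B = 1 / 2 * (1 / √(1 + 3 * v / 4)) := by
    rw [hB, integral_exp_neg_sq_gaussianReal 0 hs hl0, hl,
      show 1 + 3 * (1 + v) = 2 ^ 2 * (1 + 3 * v / 4) by ring, Real.sqrt_mul (by positivity),
      Real.sqrt_sq (by norm_num)]
    have : √(1 + 3 * v / 4) ≠ 0 := (Real.sqrt_pos.2 (by positivity)).ne'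
    field_simp
    simp
  -- the one-dimensional factor of the test density
  set φ : ℝ → ℝ := fun y => exp (θ * b y - (θ * B + θ ^ 2 / 8)) with hφ
  have hφle : ∫ y, φ y ∂gaussianReal 0 (l * s) ≤ 1 := by
    have h := integral_exp_le_of_mem_Icc (μ := gaussianReal 0 (l * s)) (f := fun y => θ * b y)
      (l := 0) (u := θ) (by fun_prop) (ae_of_all _ fun y =>
        ⟨mul_nonneg hθ (exp_neg_sq_mem_Icc y).1, mul_le_of_le_one_right hθ (exp_neg_sq_mem_Icc y).2⟩)
    rw [integral_const_mul, ← hB] at h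
    simp only [hφ, Real.exp_sub]
    rw [integral_div, div_le_one (exp_pos _)]
    simpa using h
  have hφi : Integrable φ (gaussianReal 0 (l * s)) := by
    refine Integrable.of_mem_Icc 0 (exp (θ * 1 - (θ * B + θ ^ 2 / 8))) (by fun_prop)
      (ae_of_all _ fun y => ⟨(exp_pos _).le, ?_⟩)
    exact Real.exp_le_exp.2 (sub_le_sub_right
      (mul_le_mul_of_nonneg_left (exp_neg_sq_mem_Icc y).2 hθ) _)
  set ψ : ℝ → ℝ := fun y => scaleDens l s y * φ y with hψ
  have hψi : Integrable ψ (gaussianReal 0 s) := (integrable_scaleDens_mul_iff hl0 hs φ).2 hφi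
  have hψ1 : ∫ y, ψ y ∂gaussianReal 0 s ≤ 1 := by
    rw [hψ, integral_scaleDens_mul hl0 hs]; exact hφle
  have hψ0 : 0 ≤ ∫ y, ψ y ∂gaussianReal 0 s :=
    integral_nonneg fun y => mul_nonneg (scaleDens_nonneg _ _ _) (exp_pos _).le
  have hEi : Integrable (fun y : ι → ℝ => ∏ i, ψ (y i)) (gaussPi ι s) :=
    Integrable.fintype_prod fun _ => hψi
  have hE : ∫ y : ι → ℝ, ∏ i, ψ (y i) ∂gaussPi ι s ≤ 1 := by
    unfold gaussPi
    rw [integral_fintype_prod_eq_pow]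
    exact pow_le_one₀ hψ0 hψ1
  set C := (1 - (l : ℝ)⁻¹) / (2 * s) with hC
  set K := N * (-(1 / 2 * log (1 + v)) - (θ * B + θ ^ 2 / 8)) with hK
  set g : (ι → ℝ) → ℝ := fun y => C * (y ⬝ᵥ y) + θ * ∑ i, b (y i) + K with hg
  have hexpg : ∀ y, exp (g y) = ∏ i, ψ (y i) := by
    intro y
    have e1 : ∀ i, ψ (y i) = exp (C * (y i * y i) + θ * b (y i) +
        (-(1 / 2 * log (1 + v)) - (θ * B + θ ^ 2 / 8))) := by
      intro i
      have e2 : (√(l : ℝ))⁻¹ = exp (-(1 / 2 * log (1 + v))) := by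
        rw [Real.exp_neg, hl, Real.sqrt_eq_rpow, Real.rpow_def_of_pos (by positivity), mul_comm]
      simp only [hψ, hφ, scaleDens, e2, ← Real.exp_add]
      congr 1
      ring
    simp_rw [e1]
    rw [← Real.exp_sum, Finset.sum_add_distrib, Finset.sum_add_distrib, Finset.sum_const,
      ← Finset.mul_sum, ← Finset.mul_sum, Finset.card_univ, nsmul_eq_mul]
    rfl
  have hpt : ∀ y, (∑ x ∈ X, a x * (expTilt s x y * (g y + 1))) - ∏ i, ψ (y i) ≤
      mixZ X a s y * log (mixZ X a s y) := by
    intro y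
    have h := mul_log_ge (mixZ_pos hX ha s y) (g y)
    rw [hexpg] at h
    refine le_trans (le_of_eq ?_) h
    rw [mixZ, Finset.sum_mul, ← Finset.sum_add_distrib]
    congr 1
    exact Finset.sum_congr rfl fun x _ => by ring
  have hbi : ∀ (x : ι → ℝ) (i : ι), Integrable (fun y => expTilt s x y * b (y i)) (gaussPi ι s) := by
    intro x i
    rw [integrable_expTilt_mul_iff]
    exact Integrable.of_mem_Icc 0 1 (hbm.comp (measurable_pi_apply i)).aemeasurable (ae_of_all _ fun y => exp_neg_sq_mem_Icc (y i))
  have hbI : ∀ (x : ι → ℝ) (i : ι), ∫ y, expTilt s x y * b (y i) ∂gaussPi ι s =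
      1 / 2 * exp (-(3 / 8 * s * x i ^ 2)) := by
    intro x i
    rw [integral_expTilt_mul, integral_comp_eval_pi (μ := fun i => gaussianReal (s * x i) s) i
      (f := b) (by fun_prop)]
    have := integral_exp_neg_sq_gaussianReal (s * x i) hs one_ne_zero
    rw [one_mul] at this
    rw [hb, this, NNReal.coe_one, show (1 : ℝ) + 3 * 1 = 2 ^ 2 by norm_num,
      Real.sqrt_sq (by norm_num), div_eq_inv_mul]
    congr 2
    · norm_num
    · field_simp
      ring
  have hsplit : ∀ x y : ι → ℝ, expTilt s x y * (g y + 1) =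
      C * (expTilt s x y * (y ⬝ᵥ y)) + θ * ∑ i, expTilt s x y * b (y i) +
        (K + 1) * expTilt s x y := by
    intro x y
    simp only [hg]
    rw [← Finset.mul_sum]
    ring
  have j1 : ∀ x : ι → ℝ, Integrable (fun y => C * (expTilt s x y * (y ⬝ᵥ y))) (gaussPi ι s) :=
    fun x => (integrable_expTilt_mul_normSq s x).const_mul C
  have j2 : ∀ x : ι → ℝ, Integrable (fun y => θ * ∑ i, expTilt s x y * b (y i)) (gaussPi ι s) :=
    fun x => (integrable_finsetSum _ fun i _ => hbi x i).const_mul θ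
  have j3 : ∀ x : ι → ℝ, Integrable (fun y => (K + 1) * expTilt s x y) (gaussPi ι s) :=
    fun x => (integrable_expTilt s x).const_mul _
  have hgi : ∀ x : ι → ℝ, Integrable (fun y => expTilt s x y * (g y + 1)) (gaussPi ι s) := by
    intro x
    simp_rw [hsplit]
    exact ((j1 x).add (j2 x)).add (j3 x)
  have hgI : ∀ x : ι → ℝ, ∫ y, expTilt s x y * (g y + 1) ∂gaussPi ι s =
      C * (s * N + s ^ 2 * (x ⬝ᵥ x)) + θ * ∑ i, 1 / 2 * exp (-(3 / 8 * s * x i ^ 2)) + (K + 1) := by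
    intro x
    simp_rw [hsplit]
    rw [integral_add (f := fun y => _ + _) ((j1 x).add (j2 x)) (j3 x), integral_add (j1 x) (j2 x),
      integral_const_mul, integral_const_mul, integral_const_mul, integral_expTilt_mul_normSq,
      integral_expTilt, integral_finsetSum _ fun i _ => hbi x i]
    simp_rw [hbI]
    ring
  have hZi : ∀ x ∈ X, Integrable (fun y => a x * (expTilt s x y * (g y + 1))) (gaussPi ι s) :=
    fun x _ => (hgi x).const_mul _
  have hmain := integral_mono ((integrable_finsetSum X hZi).sub hEi)
    (integrable_mixZ_mul_log hX ha s) hpt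
  rw [integral_sub' (integrable_finsetSum X hZi) hEi, integral_finsetSum _ hZi] at hmain
  simp only [integral_const_mul, hgI] at hmain
  have hlow : C * (s * N + s ^ 2 * (k * Sb)) + θ * (1 / 2 * (N - k + k * exp (-r))) + (K + 1) ≤
      ∑ x ∈ X, a x * (C * (s * N + s ^ 2 * (x ⬝ᵥ x)) +
        θ * ∑ i, 1 / 2 * exp (-(3 / 8 * s * x i ^ 2)) + (K + 1)) := by
    have h1 : ∀ x ∈ X, a x * (C * (s * N) + K + 1 +
        θ * (1 / 2 * (N - k + exp (-r) * (k * (1 + r))))) +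
        (C * s ^ 2 - θ * (1 / 2 * (exp (-r) * (3 / 8 * s)))) * (a x * (x ⬝ᵥ x)) ≤
        a x * (C * (s * N + s ^ 2 * (x ⬝ᵥ x)) +
        θ * ∑ i, 1 / 2 * exp (-(3 / 8 * s * x i ^ 2)) + (K + 1)) := by
      intro x hx
      have h2 := sum_exp_neg_sq_ge (hk x hx) (3 / 8 * s) r
      rw [← Finset.mul_sum]
      have h3 := mul_le_mul_of_nonneg_left h2 (by have := ha x hx; positivity : 0 ≤ a x * θ * (1 / 2))
      linarith
    refine le_trans (le_of_eq ?_) (Finset.sum_le_sum h1)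
    rw [Finset.sum_add_distrib, ← Finset.sum_mul, ← Finset.mul_sum, ha1, hS, hr]
    ring
  have hmE : mixEnt X a s = ∫ y, mixZ X a s y * log (mixZ X a s y) ∂gaussPi ι s := rfl
  rw [← hmE] at hmain
  have hfin : C * (s * N + s ^ 2 * (k * Sb)) + θ * (1 / 2 * (N - k + k * exp (-r))) + (K + 1) ≤
      mixEnt X a s + 1 := by linarith [hE]
  have hCval : C * (s * N + s ^ 2 * (k * Sb)) = N / 2 * v := by
    have hvN : (k : ℝ) * Sb * s = v * N := by rw [hv]; field_simp
    have : (s : ℝ) * N + s ^ 2 * (k * Sb) = s * N * (1 + v) := by linear_combination s * hvN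
    rw [this, hC, hl]
    have : 1 + v ≠ 0 := by positivity
    field_simp
    ring
  rw [hCval, hK, hBval] at hfin
  have hfin' : N / 2 * v + θ * (1 / 2 * (N - k + k * exp (-r))) + N * (-(1 / 2 * log (1 + v)) -
      (θ * (1 / 2 * (1 / √(1 + 3 * v / 4))) + θ ^ 2 / 8)) ≤ mixEnt X a s := by linarith
  refine le_trans (le_of_eq ?_) hfin'
  field_simp
  ring

end

lemma sum_sq_le_card_support_mul {ι : Type*} [Fintype ι] (x : ι → ℝ) :
    (∑ i, x i) ^ 2 ≤ (univ.filter fun i => x i ≠ 0).card * (x ⬝ᵥ x) := by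
  have h3 : x ⬝ᵥ x = ∑ i ∈ univ.filter fun i => x i ≠ 0, x i ^ 2 := by
    rw [Finset.sum_filter_of_ne]
    · exact Finset.sum_congr rfl fun i _ => by ring
    · rintro i - h h0
      simp [h0] at h
  have h4 : ∑ i, x i = ∑ i ∈ univ.filter fun i => x i ≠ 0, x i := by
    rw [Finset.sum_filter_of_ne]
    exact fun i _ h => h
  rw [h3, h4]
  exact sq_sum_le_card_mul_sum_sq

section
variable {ι : Type} [Fintype ι] [DecidableEq ι] {U : Finset ℝ} {k : ℕ}

lemma mem_sparseVecs {x : ι → ℝ} : x ∈ sparseVecs U ι k ↔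
    (∀ i, x i = 0 ∨ x i ∈ U) ∧ (univ.filter fun i => x i ≠ 0).card = k := by
  unfold sparseVecs
  rw [Finset.mem_filter, Fintype.mem_piFinset]
  simp only [Finset.mem_insert]

lemma sparseVecs_nonempty (hU : U.Nonempty) (hU0 : ∀ u ∈ U, u ≠ 0) (hk : k ≤ Fintype.card ι) :
    (sparseVecs U ι k).Nonempty := by
  obtain ⟨u, hu⟩ := hU
  obtain ⟨T, -, hT⟩ := Finset.exists_subset_card_eq (s := (univ : Finset ι)) (by simpa using hk)
  refine ⟨fun i => if i ∈ T then u else 0, mem_sparseVecs.2 ⟨fun i => ?_, ?_⟩⟩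
  · by_cases h : i ∈ T <;> simp [h, hu]
  · rw [← hT]
    congr 1
    ext i
    simp [hU0 u hu]

lemma sparseVecs_dotProduct_self_le {B : ℝ} (hB : ∀ u ∈ U, u ^ 2 ≤ B) {x : ι → ℝ}
    (hx : x ∈ sparseVecs U ι k) : x ⬝ᵥ x ≤ k * B := by
  rw [mem_sparseVecs] at hx
  obtain ⟨h1, h2⟩ := hx
  have h3 : x ⬝ᵥ x = ∑ i ∈ univ.filter fun i => x i ≠ 0, x i ^ 2 := by
    rw [Finset.sum_filter_of_ne]
    · exact Finset.sum_congr rfl fun i _ => by ring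
    · rintro i - h h0
      simp [h0] at h
  rw [h3, ← h2, ← nsmul_eq_mul]
  refine Finset.sum_le_card_nsmul _ _ _ fun i hi => ?_
  exact hB _ ((h1 i).resolve_left (Finset.mem_filter.1 hi).2)

lemma update_mem_sparseVecs (hU0 : ∀ u ∈ U, u ≠ 0) {x : ι → ℝ} (hx : x ∈ sparseVecs U ι k) {i : ι}
    (hi : x i ≠ 0) {u : ℝ} (hu : u ∈ U) : Function.update x i u ∈ sparseVecs U ι k := by
  rw [mem_sparseVecs] at hx ⊢
  refine ⟨fun j => ?_, ?_⟩
  · by_cases h : j = i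
    · subst h; simp [hu]
    · simpa [Function.update_of_ne h] using hx.1 j
  · rw [← hx.2]
    congr 1
    ext j
    by_cases h : j = i
    · subst h; simp [hi, hU0 u hu]
    · simp [Function.update_of_ne h]

lemma sparseVecs_sum_sq_apply (hU0 : ∀ u ∈ U, u ≠ 0) (i : ι) :
    U.card * ∑ x ∈ sparseVecs U ι k, x i ^ 2 =
      (∑ u ∈ U, u ^ 2) * ∑ x ∈ sparseVecs U ι k, if x i ≠ 0 then (1 : ℝ) else 0 := by
  set P := ((sparseVecs U ι k).filter fun x => x i ≠ 0) ×ˢ U with hP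
  have h1 : ∑ p ∈ P, p.1 i ^ 2 = ∑ p ∈ P, p.2 ^ 2 := by
    refine Finset.sum_bij' (fun p _ => (Function.update p.1 i p.2, p.1 i))
      (fun p _ => (Function.update p.1 i p.2, p.1 i)) ?_ ?_ ?_ ?_ ?_
    · rintro ⟨x, u⟩ h
      simp only [hP, Finset.mem_product, Finset.mem_filter] at h ⊢
      refine ⟨⟨update_mem_sparseVecs hU0 h.1.1 h.1.2 h.2, by simpa using hU0 u h.2⟩, ?_⟩
      exact ((mem_sparseVecs.1 h.1.1).1 i).resolve_left h.1.2
    · rintro ⟨x, u⟩ h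
      simp only [hP, Finset.mem_product, Finset.mem_filter] at h ⊢
      refine ⟨⟨update_mem_sparseVecs hU0 h.1.1 h.1.2 h.2, by simpa using hU0 u h.2⟩, ?_⟩
      exact ((mem_sparseVecs.1 h.1.1).1 i).resolve_left h.1.2
    · rintro ⟨x, u⟩ h
      simp
    · rintro ⟨x, u⟩ h
      simp
    · rintro ⟨x, u⟩ h
      simp
  rw [hP, Finset.sum_product, Finset.sum_product] at h1
  simp only [Finset.sum_const, nsmul_eq_mul] at h1
  have h2 : ∑ x ∈ sparseVecs U ι k, x i ^ 2 =
      ∑ x ∈ (sparseVecs U ι k).filter (fun x => x i ≠ 0), x i ^ 2 := by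
    rw [Finset.sum_filter_of_ne]
    rintro x - h h0
    simp [h0] at h
  rw [h2, Finset.mul_sum, h1, ← Finset.sum_filter, Finset.sum_const, nsmul_eq_mul, mul_one]
  ring

lemma sparseVecs_sum_dotProduct_self (hU : U.Nonempty) (hU0 : ∀ u ∈ U, u ≠ 0) :
    ∑ x ∈ sparseVecs U ι k, x ⬝ᵥ x =
      (sparseVecs U ι k).card * (k * ((∑ u ∈ U, u ^ 2) / U.card)) := by
  have hc : (U.card : ℝ) ≠ 0 := by exact_mod_cast hU.card_pos.ne'
  have h1 : ∑ x ∈ sparseVecs U ι k, x ⬝ᵥ x = ∑ i, ∑ x ∈ sparseVecs U ι k, x i ^ 2 := by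
    rw [Finset.sum_comm]
    exact Finset.sum_congr rfl fun x _ => Finset.sum_congr rfl fun i _ => by ring
  have h2 : ∑ i, ∑ x ∈ sparseVecs U ι k, (if x i ≠ 0 then (1 : ℝ) else 0) =
      (sparseVecs U ι k).card * k := by
    rw [Finset.sum_comm, ← nsmul_eq_mul, ← Finset.sum_const]
    refine Finset.sum_congr rfl fun x hx => ?_
    rw [Finset.sum_boole, (mem_sparseVecs.1 hx).2]
  have h3 : U.card * ∑ x ∈ sparseVecs U ι k, x ⬝ᵥ x =
      (∑ u ∈ U, u ^ 2) * ((sparseVecs U ι k).card * k) := by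
    rw [h1, ← h2, Finset.mul_sum, Finset.mul_sum]
    exact Finset.sum_congr rfl fun i _ => sparseVecs_sum_sq_apply hU0 i
  field_simp
  linarith

lemma sparseVecs_sum_apply_eq (i j : ι) :
    ∑ x ∈ sparseVecs U ι k, x i = ∑ x ∈ sparseVecs U ι k, x j := by
  have hmem : ∀ x ∈ sparseVecs U ι k, x ∘ Equiv.swap i j ∈ sparseVecs U ι k := by
    intro x hx
    rw [mem_sparseVecs] at hx ⊢
    refine ⟨fun l => hx.1 _, ?_⟩
    rw [← hx.2]
    refine Finset.card_equiv (Equiv.swap i j) fun l => ?_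
    simp
  refine Finset.sum_bij' (fun x _ => x ∘ Equiv.swap i j) (fun x _ => x ∘ Equiv.swap i j)
    hmem hmem ?_ ?_ ?_
  · intro x _; ext l; simp
  · intro x _; ext l; simp
  · intro x _; simp

lemma normSq_mean_sparseVecs_le [Nonempty ι] {c Q : ℝ} (hc : 0 ≤ c)
    (hc1 : c * (sparseVecs U ι k).card = 1) (hQ : ∑ x ∈ sparseVecs U ι k, c * (x ⬝ᵥ x) = Q) :
    (∑ x ∈ sparseVecs U ι k, c • x) ⬝ᵥ (∑ x ∈ sparseVecs U ι k, c • x) ≤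
      k / Fintype.card ι * Q := by
  set X := sparseVecs U ι k
  obtain ⟨i₀⟩ := ‹Nonempty ι›
  have hN : (0 : ℝ) < Fintype.card ι := by exact_mod_cast Fintype.card_pos_iff.2 ⟨i₀⟩
  set e : ℝ := c * ∑ x ∈ X, x i₀ with he
  have hb : ∀ i, (∑ x ∈ X, c • x) i = e := by
    intro i
    rw [Finset.sum_apply, he, sparseVecs_sum_apply_eq i₀ i, Finset.mul_sum]
    rfl
  have h1 : (∑ x ∈ X, c • x) ⬝ᵥ (∑ x ∈ X, c • x) = Fintype.card ι * e ^ 2 := by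
    simp only [dotProduct, hb, Finset.sum_const, Finset.card_univ, nsmul_eq_mul]
    ring
  have h2 : Fintype.card ι * e = ∑ x ∈ X, c * ∑ i, x i := by
    have h4 : ∀ i, ∑ x ∈ X, x i = ∑ x ∈ X, x i₀ := fun i => sparseVecs_sum_apply_eq i i₀
    rw [← Finset.mul_sum, Finset.sum_comm, Finset.sum_congr rfl fun i _ => h4 i, Finset.sum_const,
      Finset.card_univ, nsmul_eq_mul]
    ring
  have h3 : (Fintype.card ι * e) ^ 2 ≤ k * Q := by
    have h5 : (∑ x ∈ X, c * ∑ i, x i) ^ 2 ≤ (∑ x ∈ X, c) * ∑ x ∈ X, c * (∑ i, x i) ^ 2 := by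
      refine Finset.sum_sq_le_sum_mul_sum_of_sq_le_mul X (fun _ _ => hc)
        (fun x _ => mul_nonneg hc (sq_nonneg _)) fun x _ => le_of_eq (by ring)
    rw [Finset.sum_const, nsmul_eq_mul, mul_comm _ c, hc1, one_mul] at h5
    rw [h2, ← hQ, Finset.mul_sum]
    refine h5.trans (Finset.sum_le_sum fun x hx => ?_)
    have h6 := sum_sq_le_card_support_mul x
    rw [(mem_sparseVecs.1 hx).2] at h6
    nlinarith [mul_le_mul_of_nonneg_left h6 hc]
  rw [h1, div_mul_eq_mul_div, le_div_iff₀ hN]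
  linarith

end

lemma card_inv_pos {α : Type*} {X : Finset α} (hX : X.Nonempty) : 0 < (X.card : ℝ)⁻¹ := by
  have := hX.card_pos
  positivity

lemma ofReal_card_inv {α : Type*} {X : Finset α} (hX : X.Nonempty) : ENNReal.ofReal (X.card : ℝ)⁻¹ = (X.card : ℝ≥0∞)⁻¹ := by
  rw [ENNReal.ofReal_inv_of_pos (by exact_mod_cast hX.card_pos), ENNReal.ofReal_natCast]

section
variable {ι : Type*} [Fintype ι]

lemma lintegral_uniformOn_prod {α β : Type*} [MeasurableSpace α] [MeasurableSpace β] (X : Finset α)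
    (μ : Measure β) [SFinite μ] {F : α × β → ℝ≥0∞} (hF : Measurable F) :
    ∫⁻ z, F z ∂((_root_.uniformOn X).prod μ) = ∑ x ∈ X, (X.card : ℝ≥0∞)⁻¹ * ∫⁻ w, F (x, w) ∂μ := by
  have hm : Measurable fun x => ∫⁻ w, F (x, w) ∂μ := hF.lintegral_prod_right'
  rw [lintegral_prod _ hF.aemeasurable]
  unfold _root_.uniformOn
  rw [lintegral_smul_measure, lintegral_finsetSum_measure, smul_eq_mul, Finset.mul_sum]
  exact Finset.sum_congr rfl fun x _ => by rw [lintegral_dirac' _ hm]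

lemma gaussPi_map_smul (s : ℝ≥0) (c : ℝ≥0) :
    (gaussPi ι s).map (fun y => (c : ℝ) • y) = gaussPi ι (c ^ 2 * s) := by
  have e : (gaussianReal 0 s).map (fun y => (c : ℝ) * y) = gaussianReal 0 (c ^ 2 * s) := by
    rw [gaussianReal_map_const_mul, mul_zero]
    congr 1
  have := Measure.pi_map_pi (μ := fun _ : ι => gaussianReal 0 s)
    (f := fun _ y => (c : ℝ) * y) (hμ := fun i => by
      rw [e]; infer_instance) (fun i => by fun_prop)
  simp only [e] at this
  exact this

lemma lintegral_gaussPi_add {s τ : ℝ≥0} (hs : s * τ = 1) (x : ι → ℝ) {G : (ι → ℝ) → ℝ≥0∞}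
    (hG : Measurable G) :
    ∫⁻ w, G (x + w) ∂gaussPi ι τ =
      ∫⁻ y, ENNReal.ofReal (expTilt s x y) * G ((τ : ℝ) • y) ∂gaussPi ι s := by
  have hs' : (s : ℝ) * τ = 1 := by exact_mod_cast hs
  have e : τ ^ 2 * s = τ := by rw [sq, mul_assoc, mul_comm τ s, hs, mul_one]
  rw [lintegral_mul_expTilt s x (F := fun y => G ((τ : ℝ) • y)) (by fun_prop)]
  conv_lhs => rw [← e, ← gaussPi_map_smul]
  rw [lintegral_map (by fun_prop) (by fun_prop)]
  refine lintegral_congr fun y => ?_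
  congr 1
  rw [smul_add, smul_smul, mul_comm (τ : ℝ) s, hs', one_smul, add_comm]

variable {X : Finset (ι → ℝ)}

lemma lintegral_map_add_uniformOn (hX : X.Nonempty) {s τ : ℝ≥0} (hs : s * τ = 1)
    {G : (ι → ℝ) → ℝ≥0∞} (hG : Measurable G) :
    ∫⁻ y, G y ∂((_root_.uniformOn X).prod (gaussPi ι τ)).map (fun z => z.1 + z.2) =
      ∫⁻ y, ENNReal.ofReal (mixZ X (fun _ => (X.card : ℝ)⁻¹) s y) * G ((τ : ℝ) • y)
        ∂gaussPi ι s := by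
  have hc := card_inv_pos hX
  rw [lintegral_map hG (by fun_prop), lintegral_uniformOn_prod X _ (by fun_prop)]
  simp only [lintegral_gaussPi_add hs _ hG]
  have hm : ∀ x : ι → ℝ, Measurable fun y => ENNReal.ofReal (expTilt s x y) * G ((τ : ℝ) • y) :=
    fun x => (measurable_expTilt _ x).ennreal_ofReal.mul (by fun_prop)
  simp only [← lintegral_const_mul _ (hm _)]
  rw [← lintegral_finsetSum _ fun x _ => (hm x).const_mul _]
  refine lintegral_congr fun y => ?_
  rw [mixZ, ENNReal.ofReal_sum_of_nonneg fun x _ => by have := expTilt_pos s x y; positivity,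
    Finset.sum_mul]
  refine Finset.sum_congr rfl fun x _ => ?_
  rw [ENNReal.ofReal_mul hc.le, ofReal_card_inv hX, mul_assoc]

lemma sub_postSq_le_lintegral (hX : X.Nonempty) {s τ : ℝ≥0} (hs : s * τ = 1)
    {f : (ι → ℝ) → ι → ℝ} (hf : Measurable f) :
    ENNReal.ofReal (∑ x ∈ X, (X.card : ℝ)⁻¹ * (x ⬝ᵥ x) - postSq X (fun _ => (X.card : ℝ)⁻¹) s) ≤
      ∫⁻ z, ENNReal.ofReal (∑ i, (z.1 i - f (z.1 + z.2) i) ^ 2)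
        ∂((_root_.uniformOn X).prod (gaussPi ι τ)) := by
  have hc := card_inv_pos hX
  set c := (X.card : ℝ)⁻¹ with hcdef
  have ha : ∀ x ∈ X, 0 < (fun _ : ι → ℝ => c) x := fun _ _ => hc
  have hmG : ∀ x : ι → ℝ, Measurable fun y => ENNReal.ofReal (∑ i, (x i - f y i) ^ 2) := by
    intro x
    fun_prop
  rw [lintegral_uniformOn_prod X _ (by fun_prop)]
  simp only [fun x : ι → ℝ => lintegral_gaussPi_add hs x (hmG x)]
  have hm : ∀ x : ι → ℝ, Measurable fun y => ENNReal.ofReal (expTilt s x y) *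
      ENNReal.ofReal (∑ i, (x i - f ((τ : ℝ) • y) i) ^ 2) :=
    fun x => (measurable_expTilt _ x).ennreal_ofReal.mul (by fun_prop)
  simp only [← lintegral_const_mul _ (hm _)]
  rw [← lintegral_finsetSum _ fun x _ => (hm x).const_mul _,
    ← integral_sum_expTilt_mul (a := fun _ => c) s (fun x => x ⬝ᵥ x), postSq,
    ← integral_sub (integrable_sum_expTilt_mul s _) (integrable_mixB_div hX ha s)]
  refine (ofReal_integral_eq_lintegral_ofReal
    ((integrable_sum_expTilt_mul s _).sub (integrable_mixB_div hX ha s))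
    (ae_of_all _ fun y => sub_nonneg.2 (mixB_div_le hX ha s y))).le.trans ?_
  refine lintegral_mono fun y => ?_
  simp only [Pi.sub_apply]
  simp only [← ofReal_card_inv hX, ← hcdef]
  simp only [← ENNReal.ofReal_mul (expTilt_pos _ _ _).le, ← ENNReal.ofReal_mul hc.le]
  rw [← ENNReal.ofReal_sum_of_nonneg fun x _ => by
    have := expTilt_pos s x y
    have : 0 ≤ ∑ i, (x i - f ((τ : ℝ) • y) i) ^ 2 := Finset.sum_nonneg fun i _ => sq_nonneg _
    positivity]
  refine ENNReal.ofReal_le_ofReal ?_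
  set ξ := f ((τ : ℝ) • y)
  set B := mixB X (fun _ => c) s y with hB
  have hZ := mixZ_pos hX ha s y
  have e1 : ∀ x : ι → ℝ, ∑ i, (x i - ξ i) ^ 2 = x ⬝ᵥ x - 2 * (ξ ⬝ᵥ x) + ξ ⬝ᵥ ξ := by
    intro x
    simp only [dotProduct, Finset.mul_sum, ← Finset.sum_sub_distrib, ← Finset.sum_add_distrib]
    exact Finset.sum_congr rfl fun i _ => by ring
  have e2 : ∑ x ∈ X, c * (expTilt s x y * ∑ i, (x i - ξ i) ^ 2) =
      (∑ x ∈ X, c * expTilt s x y * (x ⬝ᵥ x)) - 2 * (ξ ⬝ᵥ B) +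
        mixZ X (fun _ => c) s y * (ξ ⬝ᵥ ξ) := by
    rw [hB, dotProduct_mixB, mixZ, Finset.sum_mul, Finset.mul_sum, ← Finset.sum_sub_distrib,
      ← Finset.sum_add_distrib]
    exact Finset.sum_congr rfl fun x _ => by rw [e1]; ring
  rw [e2]
  set Z := mixZ X (fun _ => c) s y
  have h3 : 0 ≤ (Z • ξ - B) ⬝ᵥ (Z • ξ - B) := dotProduct_self_nonneg' _
  have h4 : (Z • ξ - B) ⬝ᵥ (Z • ξ - B) = Z ^ 2 * (ξ ⬝ᵥ ξ) - 2 * Z * (ξ ⬝ᵥ B) + B ⬝ᵥ B := by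
    rw [sub_dotProduct, dotProduct_sub, dotProduct_sub, smul_dotProduct, smul_dotProduct,
      dotProduct_smul, dotProduct_smul, dotProduct_comm B ξ]
    simp only [smul_eq_mul]
    ring
  have h5 : 0 ≤ ((Z • ξ - B) ⬝ᵥ (Z • ξ - B)) / Z := div_nonneg h3 hZ.le
  have h6 : ((Z • ξ - B) ⬝ᵥ (Z • ξ - B)) / Z = Z * (ξ ⬝ᵥ ξ) - 2 * (ξ ⬝ᵥ B) + B ⬝ᵥ B / Z := by
    rw [h4]; field_simp
  linarith

lemma mixEnt_nonneg (hX : X.Nonempty) {a : (ι → ℝ) → ℝ} (ha : ∀ x ∈ X, 0 < a x)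
    (ha1 : ∑ x ∈ X, a x = 1) (s : ℝ≥0) : 0 ≤ mixEnt X a s := by
  have h : ∫ y, (mixZ X a s y - 1) ∂gaussPi ι s ≤ mixEnt X a s := by
    refine integral_mono ((integrable_mixZ s).sub (integrable_const 1))
      (integrable_mixZ_mul_log hX ha s) fun y => ?_
    have := mul_log_ge (mixZ_pos hX ha s y) 0
    simpa using this
  rw [integral_sub (integrable_mixZ s) (integrable_const 1), integral_mixZ, ha1] at h
  simpa using h


lemma gaussPi_withDensity_scaleDens {l s : ℝ≥0} (hl : l ≠ 0) (hs : s ≠ 0) :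
    (gaussPi ι s).withDensity (fun y => ENNReal.ofReal (∏ i, scaleDens l s (y i))) =
      gaussPi ι (l * s) :=
  pi_withDensity_ofReal (fun _ => measurable_scaleDens l s) (fun _ _ => scaleDens_nonneg _ _ _)
    fun _ => gaussianReal_withDensity_scaleDens hl hs

lemma lintegral_gaussPi_mul {s τ l : ℝ≥0} (hs : s * τ = 1) (hl : l ≠ 0) {G : (ι → ℝ) → ℝ≥0∞}
    (hG : Measurable G) :
    ∫⁻ y, G y ∂gaussPi ι (l * τ) =
      ∫⁻ y, ENNReal.ofReal (∏ i, scaleDens l s (y i)) * G ((τ : ℝ) • y) ∂gaussPi ι s := by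
  have hs0 : s ≠ 0 := left_ne_zero_of_mul_eq_one hs
  have e : τ ^ 2 * (l * s) = l * τ := by
    calc τ ^ 2 * (l * s) = l * τ * (s * τ) := by ring
      _ = l * τ := by rw [hs, mul_one]
  have hm : Measurable fun y : ι → ℝ => ENNReal.ofReal (∏ i, scaleDens l s (y i)) :=
    (Finset.measurable_prod _ fun i _ =>
      (measurable_scaleDens l s).comp (measurable_pi_apply i)).ennreal_ofReal
  rw [← e, ← gaussPi_map_smul, lintegral_map hG (by fun_prop), ← gaussPi_withDensity_scaleDens hl hs0,
    lintegral_withDensity_eq_lintegral_mul _ hm (by fun_prop)]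
  rfl

lemma log_prod_scaleDens {l s : ℝ} (hl : 0 < l) (y : ι → ℝ) :
    log (∏ i, scaleDens l s (y i)) =
      Fintype.card ι * (-(1 / 2 * log l)) + (1 - l⁻¹) / (2 * s) * (y ⬝ᵥ y) := by
  have h : 0 < √l := Real.sqrt_pos.2 hl
  rw [Real.log_prod fun i _ => by unfold scaleDens; positivity]
  have e : ∀ i, log (scaleDens l s (y i)) =
      -(1 / 2 * log l) + (1 - l⁻¹) / (2 * s) * (y i * y i) := by
    intro i
    rw [scaleDens, Real.log_mul (by positivity) (by positivity), Real.log_exp, Real.log_inv,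
      Real.log_sqrt hl.le]
    ring
  simp only [e, Finset.sum_add_distrib, Finset.sum_const, Finset.card_univ, nsmul_eq_mul,
    ← Finset.mul_sum]
  rfl

lemma mixEnt_sub_le_klDiv [Nonempty ι] (hX : X.Nonempty) {s τ l : ℝ≥0} (hs : s * τ = 1) {S v : ℝ}
    (hS : ∑ x ∈ X, (X.card : ℝ)⁻¹ * (x ⬝ᵥ x) = S) (hv : v = S * s / Fintype.card ι)
    (hl : (l : ℝ) = 1 + v)
    (hD : _root_.klDiv (((_root_.uniformOn X).prod (gaussPi ι τ)).map fun z => z.1 + z.2)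
      (gaussPi ι (l * τ)) ≠ ⊤) :
    mixEnt X (fun _ => (X.card : ℝ)⁻¹) s - Fintype.card ι / 2 * (v - log (1 + v)) ≤
      (_root_.klDiv (((_root_.uniformOn X).prod (gaussPi ι τ)).map fun z => z.1 + z.2)
        (gaussPi ι (l * τ))).toReal := by
  have hN : (0 : ℝ) < Fintype.card ι := by exact_mod_cast Fintype.card_pos
  have hc := card_inv_pos hX
  have hcard : (X.card : ℝ) ≠ 0 := by exact_mod_cast hX.card_pos.ne'
  have hs' : (s : ℝ) * τ = 1 := by exact_mod_cast hs
  have hs0 : (s : ℝ) ≠ 0 := left_ne_zero_of_mul_eq_one hs'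
  have hsp : (0 : ℝ) < s := lt_of_le_of_ne s.coe_nonneg hs0.symm
  have ha : ∀ x ∈ X, 0 < (fun _ : ι → ℝ => (X.card : ℝ)⁻¹) x := fun _ _ => hc
  have hS0 : 0 ≤ S := by
    rw [← hS]
    exact Finset.sum_nonneg fun x _ => mul_nonneg hc.le (dotProduct_self_nonneg' x)
  have hv0 : 0 ≤ v := by rw [hv]; positivity
  have hlp : (0 : ℝ) < l := by rw [hl]; positivity
  have hl0 : l ≠ 0 := by exact_mod_cast hlp.ne'
  set p := ((_root_.uniformOn X).prod (gaussPi ι τ)).map fun z => z.1 + z.2 with hp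
  set a : (ι → ℝ) → ℝ := fun _ => (X.card : ℝ)⁻¹ with hadef
  set κ : (ι → ℝ) → ℝ := fun y => ∏ i, scaleDens l s (y i) with hκ
  have hκpos : ∀ y, 0 < κ y := fun y => Finset.prod_pos fun i _ => by
    have := Real.sqrt_pos.2 hlp
    unfold scaleDens; positivity
  have hκm : Measurable κ := Finset.measurable_prod _ fun i _ =>
    (measurable_scaleDens l s).comp (measurable_pi_apply i)
  set L : (ι → ℝ) → ℝ := fun y => mixZ X a s ((s : ℝ) • y) / κ ((s : ℝ) • y) with hL
  have hLm : Measurable L := by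
    have := measurable_mixZ X a s
    fun_prop
  have hLpos : ∀ y, 0 < L y := fun y => div_pos (mixZ_pos hX ha s _) (hκpos _)
  have hLT : ∀ y, L ((τ : ℝ) • y) = mixZ X a s y / κ y := by
    intro y
    simp only [hL, smul_smul, hs', one_smul]
  have hpq : p = (gaussPi ι (l * τ)).withDensity fun y => ENNReal.ofReal (L y) := by
    refine Measure.ext_of_lintegral _ fun G hG => ?_
    rw [hp, lintegral_map_add_uniformOn hX hs hG,
      lintegral_withDensity_eq_lintegral_mul _ hLm.ennreal_ofReal hG,
      lintegral_gaussPi_mul hs hl0 (hLm.ennreal_ofReal.mul hG)]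
    refine lintegral_congr fun y => ?_
    rw [Pi.mul_apply, hLT, ← mul_assoc, ← ENNReal.ofReal_mul (hκpos y).le,
      mul_div_cancel₀ _ (hκpos y).ne']
  have hllr : llr p (gaussPi ι (l * τ)) =ᵐ[p] fun y => log (L y) := by
    have h1 : p.rnDeriv (gaussPi ι (l * τ)) =ᵐ[gaussPi ι (l * τ)] fun y => ENNReal.ofReal (L y) := by
      rw [hpq]
      exact Measure.rnDeriv_withDensity _ hLm.ennreal_ofReal
    have h2 : p ≪ gaussPi ι (l * τ) := by
      rw [hpq]
      exact withDensity_absolutelyContinuous _ _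
    filter_upwards [h2.ae_le h1] with y hy
    rw [llr, hy, ENNReal.toReal_ofReal (hLpos y).le]
  have hpmap : p = ((gaussPi ι s).withDensity fun y => ENNReal.ofReal (mixZ X a s y)).map
      fun y => (τ : ℝ) • y := by
    refine Measure.ext_of_lintegral _ fun G hG => ?_
    rw [hp, lintegral_map_add_uniformOn hX hs hG, lintegral_map hG (by fun_prop),
      lintegral_withDensity_eq_lintegral_mul _ (measurable_mixZ X a s).ennreal_ofReal (by fun_prop)]
    rfl
  have hintg : ∫ y, log (L y) ∂p = ∫ y, mixZ X a s y * log (mixZ X a s y / κ y) ∂gaussPi ι s := by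
    rw [hpmap, integral_map (by fun_prop) hLm.log.aestronglyMeasurable, integral_withDensity_eq_integral_toReal_smul
      (measurable_mixZ X a s).ennreal_ofReal (ae_of_all _ fun _ => ENNReal.ofReal_lt_top)]
    refine integral_congr_ae (ae_of_all _ fun y => ?_)
    simp only [hLT, smul_eq_mul, ENNReal.toReal_ofReal (mixZ_pos hX ha s y).le]
  set C : ℝ := (1 - (l : ℝ)⁻¹) / (2 * s) with hC
  have hexp : ∀ y, mixZ X a s y * log (mixZ X a s y / κ y) = mixZ X a s y * log (mixZ X a s y) -
      (Fintype.card ι * (-(1 / 2 * log l)) * mixZ X a s y +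
        ∑ x ∈ X, C * a x * (expTilt s x y * (y ⬝ᵥ y))) := by
    intro y
    rw [Real.log_div (mixZ_pos hX ha s y).ne' (hκpos y).ne', log_prod_scaleDens hlp, ← hC]
    have : ∑ x ∈ X, C * a x * (expTilt s x y * (y ⬝ᵥ y)) = C * (mixZ X a s y * (y ⬝ᵥ y)) := by
      rw [mixZ, Finset.sum_mul, Finset.mul_sum]
      exact Finset.sum_congr rfl fun x _ => by ring
    rw [this]
    ring
  have hi1 : Integrable (fun y => Fintype.card ι * (-(1 / 2 * log l)) * mixZ X a s y)
    (gaussPi ι s) := (integrable_mixZ s).const_mul _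
  have hi2 : ∀ x ∈ X, Integrable (fun y => C * a x * (expTilt s x y * (y ⬝ᵥ y))) (gaussPi ι s) :=
    fun x _ => (integrable_expTilt_mul_normSq s x).const_mul _
  have ha1 : ∑ x ∈ X, a x = 1 := by
    rw [hadef, Finset.sum_const, nsmul_eq_mul, mul_inv_cancel₀ hcard]
  have hval : ∫ y, log (L y) ∂p = mixEnt X a s - Fintype.card ι / 2 * (v - log (1 + v)) := by
    have e1 : ∑ x ∈ X, C * a x * (s * Fintype.card ι + s ^ 2 * (x ⬝ᵥ x)) =
        C * (s * Fintype.card ι + s ^ 2 * S) := by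
      rw [← hS, Finset.mul_sum, mul_add, Finset.mul_sum]
      calc _ = (∑ x ∈ X, a x) * (C * (s * Fintype.card ι)) +
            ∑ x ∈ X, C * (s ^ 2 * (a x * (x ⬝ᵥ x))) := by
              rw [Finset.sum_mul, ← Finset.sum_add_distrib]
              exact Finset.sum_congr rfl fun x _ => by ring
        _ = _ := by rw [ha1, one_mul]
    have e2 : C * (s * Fintype.card ι + s ^ 2 * S) = Fintype.card ι / 2 * v := by
      have hvN : S * s = v * Fintype.card ι := by rw [hv]; field_simp
      have h3 : (s : ℝ) * Fintype.card ι + s ^ 2 * S = s * Fintype.card ι * l := by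
        rw [hl]; linear_combination s * hvN
      rw [h3, hC, show v = l - 1 by rw [hl]; ring]
      field_simp
    rw [hintg]
    simp only [hexp]
    rw [integral_sub (g := fun y => _ + _) (integrable_mixZ_mul_log hX ha s)
        (hi1.add (integrable_finsetSum _ hi2)),
      integral_add hi1 (integrable_finsetSum _ hi2), integral_finsetSum _ hi2, integral_const_mul,
      integral_mixZ, ha1]
    simp only [integral_const_mul, integral_expTilt_mul_normSq]
    rw [e1, e2, hl, mixEnt]
    ring
  unfold _root_.klDiv at hD ⊢
  split_ifs at hD ⊢ with h
  · rw [← hval, ← integral_congr_ae hllr]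
    rw [ENNReal.toReal_ofReal']
    exact le_max_left _ _
  · exact absurd rfl hD

end

set_option maxHeartbeats 1600000 in
lemma polynomial_margin_nonneg {u e : ℝ} (hu : 0 ≤ u) (he : 0 ≤ e) (he3 : 3 * e ≤ 1) {Y r : ℝ}
    (hY : Y = 2 + 6 * e + u) (hr : r = 3 / 8 * (Y - 1 / 2)) :
    (Y - 2 - 6 * e) ^ 2 * (2 + r) ^ 2 * (1 + 3 / 2 * e * r) ^ 2 ≤
      r ^ 4 * (1 - e) ^ 2 * (4 * Y + 2 * e * Y ^ 2 + 7 / 2 * (1 + e * Y) ^ 2) := by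
  obtain ⟨b, hb⟩ : ∃ b, b = 1 - 3 * e := ⟨_, rfl⟩
  have hb0 : 0 ≤ b := by linarith
  have h1 : 0 ≤ u * (347 / 100 - 243 / 100 * u + 51 / 100 * u ^ 2) :=
    mul_nonneg hu (by nlinarith [sq_nonneg (u - 243 / 102)])
  refine sub_nonneg.1 (le_of_le_of_eq (add_nonneg h1 (?_ : 0 ≤
      (150903/131072 * b ^ 10 + 452709/8192 * e * b ^ 9 + 38519631/32768 * e ^ 2 * b ^ 8
      + 478106631/32768 * e ^ 3 * b ^ 7 + 7668687069/65536 * e ^ 4 * b ^ 6 +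
      20759036805/32768 * e ^ 5 * b ^ 5 + 38403311031/16384 * e ^ 6 * b ^ 4 +
      191569370517/32768 * e ^ 7 * b ^ 3 + 1230469249023/131072 * e ^ 8 * b ^ 2 +
      286193044179/32768 * e ^ 9 * b + 116682182127/32768 * e ^ 10) + u *
      (119/204800 * b ^ 9 + 82092879/1638400 * e * b ^ 8 + 303211431/204800 * e ^ 2 *
      b ^ 7 + 31486375161/1638400 * e ^ 3 * b ^ 6 + 58519277253/409600 * e ^ 4 * b ^ 5 +
      1087781220261/1638400 * e ^ 5 * b ^ 4 + 201628586367/102400 * e ^ 6 * b ^ 3 +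
      5936185028439/1638400 * e ^ 7 * b ^ 2 + 1539391467087/409600 * e ^ 8 * b +
      684789540579/409600 * e ^ 9) + u ^ 2 * (653/409600 * b ^ 8 + 18850569/819200 * e
      * b ^ 7 + 3891966021/6553600 * e ^ 2 * b ^ 6 + 21519163863/3276800 * e ^ 3 * b ^ 5 +
      52687851057/1310720 * e ^ 4 * b ^ 4 + 239597646921/1638400 * e ^ 5 * b ^ 3 +
      2051138835351/6553600 * e ^ 6 * b ^ 2 + 1176759127179/3276800 * e ^ 7 * b +
      1097900832303/6553600 * e ^ 8) + u ^ 3 * (51/102400 * b ^ 7 + 1397817/204800 * e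
      * b ^ 6 + 115986087/819200 * e ^ 2 * b ^ 5 + 200098917/163840 * e ^ 3 * b ^ 4 +
      3530061/640 * e ^ 4 * b ^ 3 + 1362967803/102400 * e ^ 5 * b ^ 2 +
      12506783049/819200 * e ^ 6 * b + 4699935171/819200 * e ^ 7) + u ^ 4 * (4599/8192
      * b ^ 6 + 46791/4096 * e * b ^ 5 + 3213351/32768 * e ^ 2 * b ^ 4 + 917325/2048 *
      e ^ 3 * b ^ 3 + 9014895/8192 * e ^ 4 * b ^ 2 + 10316079/8192 * e ^ 5 * b +
      14035437/32768 * e ^ 6) + u ^ 5 * (81/1024 * b ^ 5 + 5751/4096 * e * b ^ 4 +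
      82863/8192 * e ^ 2 * b ^ 3 + 280989/8192 * e ^ 3 * b ^ 2 + 404919/8192 * e ^ 4 * b +
      169371/8192 * e ^ 5) + u ^ 6 * (0.03955078125 * e * b ^ 3 + 0.30157470703125 *
      e ^ 2 * b ^ 2 + 0.6427001953125 * e ^ 3 * b + 0.35101318359375 * e ^ 4))) ?_)
  · positivity
  · rw [hr, hY, hb]
    ring

lemma sub_sq_div_two_le_log_one_add {z : ℝ} (hz : 0 ≤ z) : z - z ^ 2 / 2 ≤ log (1 + z) := by
  refine le_trans ?_ (Real.le_log_one_add_of_nonneg hz)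
  rw [le_div_iff₀ (by positivity)]
  nlinarith [pow_nonneg hz 3]

lemma one_sub_exp_neg_le {r : ℝ} (hr : 0 ≤ r) : 1 - exp (-r) ≤ 2 * r / (2 + r) := by
  have h1 := Real.le_log_one_add_of_nonneg (x := exp r - 1) (by linarith [Real.add_one_le_exp r])
  rw [add_sub_cancel, Real.log_exp, div_le_iff₀ (by linarith [Real.add_one_le_exp r])] at h1
  have h2 : exp r * exp (-r) = 1 := by rw [← Real.exp_add]; simp
  have h3 := mul_le_mul_of_nonneg_right h1 (exp_pos (-r)).le
  rw [le_div_iff₀ (by positivity)]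
  nlinarith

lemma div_le_one_sub_one_div_sqrt {a : ℝ} (ha : 0 ≤ a) :
    a / (1 + 3 / 2 * a) ≤ 1 - 1 / √(1 + 2 * a) := by
  have h0 : 0 < √(1 + 2 * a) := Real.sqrt_pos.2 (by positivity)
  have h1 : (1 + 3 / 2 * a) / (1 + a / 2) ≤ √(1 + 2 * a) := by
    refine Real.le_sqrt_of_sq_le ?_
    rw [div_pow, div_le_iff₀ (by positivity)]
    nlinarith [pow_nonneg ha 3]
  have h2 : 1 / √(1 + 2 * a) ≤ (1 + a / 2) / (1 + 3 / 2 * a) := by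
    rw [div_le_iff₀ (by positivity)] at h1
    rw [div_le_div_iff₀ h0 (by positivity)]
    linarith
  have h3 : a / (1 + 3 / 2 * a) = 1 - (1 + a / 2) / (1 + 3 / 2 * a) := by
    field_simp
    ring
  linarith

lemma support_gain_ge {e r : ℝ} (he : 0 ≤ e) (hr : 0 ≤ r) :
    e * r ^ 2 * (1 - 3 * e) / ((1 + 3 / 2 * e * r) * (2 + r)) ≤
      1 - e * (1 - exp (-r)) - 1 / √(1 + 2 * (e * r)) := by
  have h1 := mul_le_mul_of_nonneg_left (one_sub_exp_neg_le hr) he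
  have h2 := div_le_one_sub_one_div_sqrt (mul_nonneg he hr)
  have h3 : e * r ^ 2 * (1 - 3 * e) / ((1 + 3 / 2 * e * r) * (2 + r)) =
      e * r / (1 + 3 / 2 * (e * r)) - e * (2 * r / (2 + r)) := by
    have : 1 + 3 / 2 * (e * r) ≠ 0 := by positivity
    have : 1 + 3 / 2 * e * r ≠ 0 := by positivity
    field_simp
    ring
  linarith

lemma low_snr_slack_le {e Y r : ℝ} (he : 0 < e) (he1 : e < 1) (hY : 0 ≤ Y)
    (hr : 3 / 8 * (Y - 1 / 2) ≤ r)
    (hw : 0 < e * Y / (1 + e * Y) - 2 * (e / (1 - e))) :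
    (e * Y / (1 + e * Y) - 2 * (e / (1 - e))) ^ 2 ≤
      4 * (e * Y / (1 + e * Y) - (e * Y / (1 + e * Y)) ^ 2 / 2 + 7 / 8 * (e / (1 - e))) *
        (1 / e * (1 - e * (1 - exp (-r)) - 1 / √(1 + 2 * (e * r))) ^ 2) ∧
      0 ≤ 1 - e * (1 - exp (-r)) - 1 / √(1 + 2 * (e * r)) := by
  have hb : 0 < 1 - e := by linarith
  have hg : 0 < 1 + e * Y := by positivity
  have hw' : e * Y / (1 + e * Y) - 2 * (e / (1 - e)) =
      e * (Y * (1 - 3 * e) - 2) / ((1 + e * Y) * (1 - e)) := by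
    field_simp
    ring
  have h1 : 0 < Y * (1 - 3 * e) - 2 := by
    rw [hw'] at hw
    have := (div_pos_iff_of_pos_right (by positivity)).1 hw
    exact pos_of_mul_pos_right this he.le
  have h3 : 0 < 1 - 3 * e := by
    by_contra h
    have := mul_nonpos_of_nonneg_of_nonpos hY (not_lt.1 h)
    linarith
  have hu : 0 ≤ Y - 2 - 6 * e := by
    by_contra h
    have h4 := mul_lt_mul_of_pos_right (not_le.1 h) h3
    have h5 : 0 ≤ e ^ 2 := sq_nonneg e
    linarith
  set r₀ := 3 / 8 * (Y - 1 / 2) with hr₀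
  have hr0 : 0 < r₀ := by rw [hr₀]; linarith
  have hrp : 0 < r := by linarith
  set G := e * r ^ 2 * (1 - 3 * e) / ((1 + 3 / 2 * e * r) * (2 + r)) with hG
  set G₀ := e * r₀ ^ 2 * (1 - 3 * e) / ((1 + 3 / 2 * e * r₀) * (2 + r₀)) with hG₀
  have hGG : G₀ ≤ G := by
    rw [hG, hG₀, div_le_div_iff₀ (by positivity) (by positivity)]
    have e1 : 0 ≤ e * (1 - 3 * e) := by positivity
    have e2 : r₀ ^ 2 * ((1 + 3 / 2 * e * r) * (2 + r)) ≤
        r ^ 2 * ((1 + 3 / 2 * e * r₀) * (2 + r₀)) := by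
      have a1 : r₀ * (1 + 3 / 2 * e * r) ≤ r * (1 + 3 / 2 * e * r₀) := by nlinarith
      have a2 : r₀ * (2 + r) ≤ r * (2 + r₀) := by nlinarith
      have := mul_le_mul a1 a2 (by positivity) (by positivity)
      linarith
    have := mul_le_mul_of_nonneg_left e2 e1
    linarith
  have hG0 : 0 ≤ G₀ := by rw [hG₀]; positivity
  have hgain := hGG.trans (support_gain_ge he.le hrp.le)
  refine ⟨?_, hG0.trans hgain⟩
  have hsq := pow_le_pow_left₀ hG0 hgain 2
  set Δ := 1 - e * (1 - exp (-r)) - 1 / √(1 + 2 * (e * r))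
  set E := e * Y / (1 + e * Y) - (e * Y / (1 + e * Y)) ^ 2 / 2 + 7 / 8 * (e / (1 - e)) with hE
  set H := 4 * Y + 2 * e * Y ^ 2 + 7 / 2 * (1 + e * Y) ^ 2 with hH
  have hE1 : e * H / (1 + e * Y) ^ 2 ≤ 4 * E := by
    have h5 : e ≤ e / (1 - e) := by
      rw [le_div_iff₀ hb]; nlinarith
    have h6 : e * H / (1 + e * Y) ^ 2 =
        4 * (e * Y / (1 + e * Y) - (e * Y / (1 + e * Y)) ^ 2 / 2 + 7 / 8 * e) := by
      rw [hH]
      field_simp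
      ring
    rw [h6, hE]
    linarith
  have hpoly := polynomial_margin_nonneg hu he.le (by linarith) (Y := Y) (r := r₀) (by ring) hr₀
  rw [← hH] at hpoly
  have hwle : e * Y / (1 + e * Y) - 2 * (e / (1 - e)) ≤
      e * (1 - 3 * e) * (Y - 2 - 6 * e) / ((1 + e * Y) * (1 - e)) := by
    rw [hw']
    refine div_le_div_of_nonneg_right ?_ (by positivity)
    have h7 : e * (1 - 3 * e) * (Y - 2 - 6 * e) = e * (Y * (1 - 3 * e) - 2) + 18 * e ^ 3 := by ring
    rw [h7]
    exact le_add_of_nonneg_right (by positivity)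
  calc _ ≤ (e * (1 - 3 * e) * (Y - 2 - 6 * e) / ((1 + e * Y) * (1 - e))) ^ 2 :=
        pow_le_pow_left₀ hw.le hwle 2
    _ ≤ e * H / (1 + e * Y) ^ 2 * (1 / e * G₀ ^ 2) := by
        have e1 : e * H / (1 + e * Y) ^ 2 * (1 / e * G₀ ^ 2) =
            (e * (1 - 3 * e) / ((1 + e * Y) * (1 - e) * (2 + r₀) * (1 + 3 / 2 * e * r₀))) ^ 2 *
              (r₀ ^ 4 * (1 - e) ^ 2 * H) := by
          rw [hG₀]
          field_simp
        have e2 : (e * (1 - 3 * e) * (Y - 2 - 6 * e) / ((1 + e * Y) * (1 - e))) ^ 2 =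
            (e * (1 - 3 * e) / ((1 + e * Y) * (1 - e) * (2 + r₀) * (1 + 3 / 2 * e * r₀))) ^ 2 *
              ((Y - 2 - 6 * e) ^ 2 * (2 + r₀) ^ 2 * (1 + 3 / 2 * e * r₀) ^ 2) := by
          field_simp
        rw [e1, e2]
        exact mul_le_mul_of_nonneg_left hpoly (sq_nonneg _)
    _ ≤ 4 * E * (1 / e * Δ ^ 2) := by
        refine mul_le_mul hE1 (mul_le_mul_of_nonneg_left hsq (by positivity)) (by positivity) ?_
        exact le_trans (by positivity) hE1

lemma mul_le_of_sq_le {t w E Q : ℝ} (hE : 0 < E) (h : w ^ 2 ≤ 4 * E * Q) :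
    t * w ≤ t ^ 2 * E + Q := by
  have h1 : 0 ≤ (2 * t * E - w) ^ 2 := sq_nonneg _
  have h2 : 0 ≤ 4 * E * (t ^ 2 * E + Q - t * w) := by nlinarith
  have := nonneg_of_mul_nonneg_right h2 (by positivity)
  linarith

lemma mul_div_one_add_le {t K e Y r b P : ℝ} (ht : 0 < t) (hK : 1 ≤ K) (he : 0 < e) (he1 : e < 1)
    (hY : 0 ≤ Y) (hr : 3 / 8 * (Y - 1 / 2) ≤ r) (hb : b = K * (e / (1 - e)))
    (hP : t * b * (2 + 7 / 8 * t) ≤ P) :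
    t * (e * Y / (1 + e * Y)) ≤ P +
      t ^ 2 * (e * Y / (1 + e * Y) - (e * Y / (1 + e * Y)) ^ 2 / 2) +
      K / e * (max (1 - e * (1 - exp (-r)) - 1 / √(1 + 2 * (e * r))) 0) ^ 2 := by
  have hK0 : 0 < K := by linarith
  have h1e : 0 < 1 - e := by linarith
  set x := e * Y / (1 + e * Y) with hx
  have hx0 : 0 ≤ x := by positivity
  have hx1 : x ≤ 1 := by
    rw [hx, div_le_one (by positivity)]
    linarith
  have hb1 : e / (1 - e) ≤ b := by
    rw [hb]
    have : 0 < e / (1 - e) := by positivity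
    nlinarith
  have hbp : 0 < e / (1 - e) := by positivity
  have hb0 : 0 < b := hbp.trans_le hb1
  rcases le_or_gt x (2 * b) with h | h
  · have h1 := mul_le_mul_of_nonneg_left h ht.le
    have h2 : 0 ≤ t ^ 2 * (x - x ^ 2 / 2) := mul_nonneg (sq_nonneg _) (by nlinarith)
    have h3 : 0 ≤ t * b * (7 / 8 * t) := by positivity
    have h4 : 0 ≤ K / e * (max (1 - e * (1 - exp (-r)) - 1 / √(1 + 2 * (e * r))) 0) ^ 2 := by
      positivity
    linarith
  · obtain ⟨h1, h2⟩ := low_snr_slack_le he he1 hY hr (by rw [← hx]; linarith)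
    rw [max_eq_left h2]
    rw [← hx] at h1
    set Δ := 1 - e * (1 - exp (-r)) - 1 / √(1 + 2 * (e * r))
    have hE0 : 0 < x - x ^ 2 / 2 + 7 / 8 * (e / (1 - e)) := by nlinarith
    have h3 : (x - 2 * b) ^ 2 ≤ 4 * (x - x ^ 2 / 2 + 7 / 8 * b) * (K / e * Δ ^ 2) := by
      refine (pow_le_pow_left₀ (by linarith) (by linarith :
        x - 2 * b ≤ x - 2 * (e / (1 - e))) 2).trans (h1.trans ?_)
      refine mul_le_mul (by linarith) ?_ (mul_nonneg (by positivity) (sq_nonneg Δ)) (by linarith)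
      refine mul_le_mul_of_nonneg_right ?_ (sq_nonneg _)
      exact div_le_div_of_nonneg_right hK he.le
    have h4 := mul_le_of_sq_le (t := t) (by linarith) h3
    linarith

lemma exponent_le_of_step_le {t σ μ v v' N P Q D Ψ Ψ' : ℝ} (ht : 0 < t) (ht1 : t < 1 / 2)
    (hσ0 : 0 ≤ σ) (hσ1 : σ ≤ 1) (hμ0 : 0 ≤ μ) (hμ : μ ≤ σ / (1 + v)) (hN : 0 < N) (hv' : 0 ≤ v')
    (hvv : N * (v - v') = σ * t) (hΨ : 2 * Ψ' + t * (σ - μ) - σ * t ^ 2 / 2 ≤ 2 * Ψ)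
    (hΨ' : N / 2 * (v' - log (1 + v')) + Q / 2 ≤ Ψ') (hD : Ψ - N / 2 * (v - log (1 + v)) ≤ D)
    (hP : t * (v / (1 + v)) ≤ P + t ^ 2 * (v / (1 + v) - (v / (1 + v)) ^ 2 / 2) + Q) :
    t * σ + log (1 - t ^ 2) - log (1 + t * μ) - P ≤ 2 * D := by
  have hv : v' ≤ v := by
    have : 0 ≤ N * (v - v') := by rw [hvv]; positivity
    linarith [nonneg_of_mul_nonneg_right this hN]
  have hv0 : 0 < 1 + v := by linarith
  set x := v / (1 + v) with hx
  have hx0 : 0 ≤ x := div_nonneg (by linarith) hv0.le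
  have hx1 : x ≤ 1 := by rw [hx, div_le_one hv0]; linarith
  have hμx : μ ≤ σ * (1 - x) := by
    refine hμ.trans (le_of_eq ?_)
    rw [hx]; field_simp; ring
  have h1 : log (1 - t ^ 2) ≤ -t ^ 2 := by
    have := Real.log_le_sub_one_of_pos (x := 1 - t ^ 2) (by nlinarith)
    linarith
  have h2 := sub_sq_div_two_le_log_one_add (mul_nonneg ht.le hμ0)
  have h3 : t * σ * (1 - x) ≤ N * (log (1 + v) - log (1 + v')) := by
    rw [← Real.log_div (by linarith) (by linarith)]
    have := Real.one_sub_inv_le_log_of_pos (x := (1 + v) / (1 + v')) (by positivity)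
    refine le_trans (le_of_eq ?_) (mul_le_mul_of_nonneg_left this hN.le)
    have h4 : N * (1 - ((1 + v) / (1 + v'))⁻¹) = N * (v - v') / (1 + v) := by
      have : 1 + v' ≠ 0 := by positivity
      field_simp
      ring
    rw [h4, hvv, hx]
    field_simp
    ring
  have h4 : μ ^ 2 ≤ 1 - 2 * x + x ^ 2 := by
    have : μ ≤ 1 - x := hμx.trans (mul_le_of_le_one_left (by linarith) hσ1)
    nlinarith
  have h5 : t ^ 2 * μ ^ 2 ≤ t ^ 2 * (1 - 2 * x + x ^ 2) :=
    mul_le_mul_of_nonneg_left h4 (sq_nonneg t)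
  have h6 : σ * t ^ 2 ≤ t ^ 2 := mul_le_of_le_one_left (sq_nonneg t) hσ1
  have h7 : σ * (t * x) ≤ t * x := mul_le_of_le_one_left (by positivity) hσ1
  linarith

lemma exponent_le_of_lt_step {t σ μ v e T N P D Ψ : ℝ} (ht : 0 < t) (ht1 : t < 1 / 2) (hσ0 : 0 ≤ σ)
    (hσ1 : σ ≤ 1) (hμ0 : 0 ≤ μ) (hμ1 : μ ≤ σ) (hμ : σ * (1 - e - T) ≤ μ) (hT0 : 0 ≤ T)
    (hT : T < t) (he : 0 ≤ e) (hN : 0 < N) (hNe : 1 ≤ N * e) (hv : N * v = σ * T)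
    (hΨ : T * (σ - μ) - σ * T ^ 2 / 2 ≤ 2 * Ψ) (hD : Ψ - N / 2 * (v - log (1 + v)) ≤ D)
    (hP : 2 * (t * e) ≤ P) :
    t * σ + log (1 - t ^ 2) - log (1 + t * μ) - P ≤ 2 * D := by
  have hv0 : 0 ≤ v := nonneg_of_mul_nonneg_right (hv ▸ mul_nonneg hσ0 hT0) hN
  have h1 : log (1 - t ^ 2) ≤ -t ^ 2 := by
    have := Real.log_le_sub_one_of_pos (x := 1 - t ^ 2) (by nlinarith)
    linarith
  have h2 := sub_sq_div_two_le_log_one_add (mul_nonneg ht.le hμ0)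
  have h3 : N * v - N * v * v ≤ N * log (1 + v) := by
    have h4 := Real.one_sub_inv_le_log_of_pos (x := 1 + v) (by linarith)
    have h5 : v - v * v ≤ 1 - (1 + v)⁻¹ := by
      have : 1 - (1 + v)⁻¹ = v / (1 + v) := by field_simp; ring
      rw [this, le_div_iff₀ (by linarith)]
      nlinarith [pow_nonneg hv0 3]
    have := mul_le_mul_of_nonneg_left (h5.trans h4) hN.le
    linarith
  have hve : v ≤ e * T := by
    have h4 : v ≤ N * e * v := le_mul_of_one_le_left hv0 hNe
    have h5 : N * e * v = e * (σ * T) := by rw [← hv]; ring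
    have h6 : e * (σ * T) ≤ e * T :=
      mul_le_mul_of_nonneg_left (mul_le_of_le_one_left hT0 hσ1) he
    linarith
  have h4 : N * v * v ≤ t * e / 2 := by
    rw [hv]
    calc σ * T * v ≤ 1 * T * (e * T) := by gcongr
      _ ≤ t * e / 2 := by nlinarith [mul_nonneg he hT0]
  have h5 : (t - T) * (σ - μ) ≤ (t - T) * (e + T) := by
    refine mul_le_mul_of_nonneg_left ?_ (by linarith)
    have : σ * (e + T) ≤ e + T := mul_le_of_le_one_left (by positivity) hσ1
    linarith
  have h6 : t ^ 2 * μ ^ 2 ≤ t ^ 2 := mul_le_of_le_one_right (sq_nonneg t) (by nlinarith)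
  have h7 : σ * T ^ 2 ≤ T ^ 2 := mul_le_of_le_one_left (sq_nonneg T) hσ1
  have h8 : 0 ≤ T * e := mul_nonneg hT0 he
  have h9 : 0 ≤ (t - T) ^ 2 := sq_nonneg _
  have h10 : 0 ≤ t * e := mul_nonneg ht.le he
  linarith

lemma exponent_le_of_half {t σ μ P D : ℝ} (ht : 0 < t) (ht1 : t < 1 / 2) (hσ1 : σ ≤ 1) (hμ0 : 0 ≤ μ)
    (hD : 0 ≤ D) (hP : t - t ^ 2 ≤ P) :
    t * σ + log (1 - t ^ 2) - log (1 + t * μ) - P ≤ 2 * D := by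
  have h1 : log (1 - t ^ 2) ≤ -t ^ 2 := by
    have := Real.log_le_sub_one_of_pos (x := 1 - t ^ 2) (by nlinarith)
    linarith
  have h2 : 0 ≤ log (1 + t * μ) := Real.log_nonneg (by nlinarith)
  have h3 : t * σ ≤ t := mul_le_of_le_one_right ht.le hσ1
  linarith

lemma add_sq_le_sqrt_sub_one {t : ℝ} (ht : 0 < t) (ht1 : t < 1 / 2) :
    t + t ^ 2 ≤ √((1 - t ^ 2) / (1 - 2 * t)) - 1 := by
  have h : 1 + t + t ^ 2 ≤ √((1 - t ^ 2) / (1 - 2 * t)) := by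
    refine Real.le_sqrt_of_sq_le ?_
    rw [le_div_iff₀ (by linarith)]
    nlinarith [pow_pos ht 3, pow_pos ht 4, pow_pos ht 5]
  linarith

lemma mul_div_one_sub_le_pow {k N : ℕ} (hk : 1 ≤ k) (hkN : k < N) :
    (k : ℝ) * ((k : ℝ) / N / (1 - (k : ℝ) / N)) ≤ (1 + ((N : ℝ) / k - 1)⁻¹) ^ k - 1 := by
  have hk0 : (0 : ℝ) < k := by exact_mod_cast hk
  have hN : (k : ℝ) < N := by exact_mod_cast hkN
  have hN0 : (0 : ℝ) < N := by linarith
  have hd : (0 : ℝ) < N - k := by linarith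
  have e1 : (k : ℝ) / N / (1 - (k : ℝ) / N) = ((N : ℝ) / k - 1)⁻¹ := by
    rw [one_sub_div hN0.ne', div_sub_one hk0.ne', inv_div]
    field_simp
  rw [e1]
  have h0 : 0 ≤ ((N : ℝ) / k - 1)⁻¹ := by
    rw [div_sub_one hk0.ne', inv_div]; positivity
  have := one_add_mul_le_pow (a := ((N : ℝ) / k - 1)⁻¹) (by linarith) k
  linarith

lemma two_mul_log_ge_of_half_lt {t f β b : ℝ} (ht : 0 < t) (ht1 : t < 1 / 2) (hf : t + t ^ 2 ≤ f)
    (hβ : b ≤ β) (hb : 1 / 2 < b) : t - t ^ 2 ≤ 2 * log (1 + f * β) := by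
  have hz : 0 ≤ (t + t ^ 2) * (1 / 2) := by positivity
  have h1 := sub_sq_div_two_le_log_one_add hz
  have h2 : log (1 + (t + t ^ 2) * (1 / 2)) ≤ log (1 + f * β) := by
    refine Real.log_le_log (by positivity) ?_
    have : (t + t ^ 2) * (1 / 2) ≤ f * β :=
      mul_le_mul hf (by linarith) (by norm_num) (le_trans (by positivity) hf)
    linarith
  nlinarith [pow_pos ht 2, pow_pos ht 3, pow_pos ht 4]

lemma two_mul_log_ge_of_le_half {t f β b : ℝ} (ht : 0 < t) (ht1 : t < 1 / 2) (hf : t + t ^ 2 ≤ f)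
    (hβ : b ≤ β) (hb0 : 0 ≤ b) (hb : b ≤ 1 / 2) :
    t * b * (2 + 7 / 8 * t) ≤ 2 * log (1 + f * β) := by
  have hz : 0 ≤ (t + t ^ 2) * b := by positivity
  have h1 := sub_sq_div_two_le_log_one_add hz
  have h2 : log (1 + (t + t ^ 2) * b) ≤ log (1 + f * β) := by
    refine Real.log_le_log (by positivity) ?_
    have : (t + t ^ 2) * b ≤ f * β := mul_le_mul hf hβ hb0 (le_trans (by positivity) hf)
    linarith
  have h3 : (1 + t) ^ 2 * b ≤ 9 / 8 := by
    have : (1 + t) ^ 2 ≤ 9 / 4 := by nlinarith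
    nlinarith
  have h4 : 0 ≤ t ^ 2 * b := by positivity
  have h5 := mul_le_mul_of_nonneg_left h3 h4
  linarith

section
variable {ι : Type*} [Fintype ι] {X : Finset (ι → ℝ)} {a : (ι → ℝ) → ℝ}

set_option maxHeartbeats 1000000 in
lemma exponent_le [Nonempty ι] (hX : X.Nonempty) (ha : ∀ x ∈ X, 0 < a x)
    (ha1 : ∑ x ∈ X, a x = 1) {k : ℕ} (hk1 : 1 ≤ k) (hkN : k < Fintype.card ι)
    (hk : ∀ x ∈ X, (univ.filter fun i => x i ≠ 0).card = k) {B Sb : ℝ} (hB : 0 < B)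
    (hSb : 0 ≤ Sb) (hSB : Sb ≤ B) (hXA : ∀ x ∈ X, x ⬝ᵥ x ≤ k * B)
    (hS : ∑ x ∈ X, a x * (x ⬝ᵥ x) = k * Sb)
    (hb : (∑ x ∈ X, a x • x) ⬝ᵥ (∑ x ∈ X, a x • x) ≤ k / Fintype.card ι * (k * Sb))
    {s : ℝ≥0} (hs : s ≠ 0) {v D : ℝ} (hv : v = k * Sb * s / Fintype.card ι) (hD0 : 0 ≤ D)
    (hD : mixEnt X a s - Fintype.card ι / 2 * (v - log (1 + v)) ≤ D) {t f β μ : ℝ} (ht : 0 < t)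
    (ht1 : t < 1 / 2) (hf : t + t ^ 2 ≤ f)
    (hβ : (k : ℝ) * ((k : ℝ) / Fintype.card ι / (1 - (k : ℝ) / Fintype.card ι)) ≤ β)
    (hμ : μ = (k * Sb - postSq X a s) / (k * B)) :
    t * (Sb / B) + log (1 - t ^ 2) - log (1 + t * μ) - 2 * log (1 + f * β) ≤ 2 * D := by
  set N : ℝ := (Fintype.card ι : ℝ) with hNdef
  have hk0 : (0 : ℝ) < k := by exact_mod_cast hk1
  have hk1' : (1 : ℝ) ≤ k := by exact_mod_cast hk1
  have hkN' : (k : ℝ) < N := by rw [hNdef]; exact_mod_cast hkN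
  have hN : 0 < N := by linarith
  have hsp : (0 : ℝ) < s := by exact_mod_cast pos_iff_ne_zero.2 hs
  have hA : (0 : ℝ) < k * B := by positivity
  set σ := Sb / B with hσ
  have hσ0 : 0 ≤ σ := by positivity
  have hσ1 : σ ≤ 1 := (div_le_one hB).2 hSB
  have hσB : σ * B = Sb := by rw [hσ]; field_simp
  have hv0 : 0 ≤ v := by rw [hv]; positivity
  have hμ0 : 0 ≤ μ := by
    have := postSq_le hX ha s
    rw [hμ, ← hS]
    exact div_nonneg (by linarith) hA.le
  have hμA : postSq X a s = k * B * (σ - μ) := by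
    rw [hμ, ← hσB]; field_simp; ring
  set e : ℝ := (k : ℝ) / N with he
  have he0 : 0 < e := by positivity
  have he1 : e < 1 := (div_lt_one hN).2 hkN'
  have h1e : 0 < 1 - e := by linarith
  have hee : e ≤ (k : ℝ) * (e / (1 - e)) := by
    have h1 : e ≤ e / (1 - e) := by
      rw [le_div_iff₀ h1e]; nlinarith
    have h2 : e / (1 - e) ≤ k * (e / (1 - e)) := le_mul_of_one_le_left (by positivity) hk1'
    linarith
  rcases lt_or_ge (1 / 2) ((k : ℝ) * (e / (1 - e))) with hb2 | hb2
  · exact exponent_le_of_half ht ht1 hσ1 hμ0 hD0 (two_mul_log_ge_of_half_lt ht ht1 hf hβ hb2)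
  have hP := two_mul_log_ge_of_le_half ht ht1 hf hβ (by positivity) hb2
  have hμv : μ ≤ σ / (1 + v) := by
    have h1 := postSq_ge hX ha ha1 hS.symm s
    have h2 : s * (k * Sb) ^ 2 / (N + s * (k * Sb)) = k * Sb * (v / (1 + v)) := by
      rw [hv]
      have : N + s * (k * Sb) ≠ 0 := by positivity
      have : 1 + k * Sb * s / N ≠ 0 := by positivity
      field_simp
    rw [← hNdef, h2] at h1
    rw [hμ, div_le_iff₀ hA]
    have h3 : σ / (1 + v) * (k * B) = k * Sb - k * Sb * (v / (1 + v)) := by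
      rw [← hσB]
      have : 1 + v ≠ 0 := by positivity
      field_simp
      ring
    linarith
  obtain ⟨h, hh⟩ : ∃ h : ℝ≥0, (h : ℝ) = t / (k * B) := ⟨⟨t / (k * B), by positivity⟩, rfl⟩
  have hhA : (h : ℝ) * (k * B) = t := by rw [hh]; field_simp
  rcases le_or_gt h s with hle | hlt
  · obtain ⟨s', rfl⟩ := exists_add_of_le hle
    rw [add_comm h s'] at *
    have hstep := mixEnt_add_ge_postSq_right hX ha hA hXA hS.symm s' h
    set v' := k * Sb * s' / N with hv'
    have hv'0 : 0 ≤ v' := by positivity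
    set r : ℝ := 3 / 8 * (s' * Sb) with hr
    have hr0 : 0 ≤ r := by positivity
    have hvr : 1 + 3 * v' / 4 = 1 + 2 * (e * r) := by
      rw [hv', he, hr]; ring
    set Δ := max (1 - e * (1 - exp (-r)) - 1 / √(1 + 2 * (e * r))) 0 with hΔ
    have hΔ0 : 0 ≤ Δ := le_max_right _ _
    have hent : N / 2 * (v' - log (1 + v')) + N * Δ ^ 2 / 2 ≤ mixEnt X a s' := by
      rcases eq_or_ne s' 0 with h0 | h0
      · have hr00 : r = 0 := by rw [hr, h0]; simp
        have hv00 : v' = 0 := by rw [hv', h0]; simp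
        have hΔ00 : Δ = 0 := by rw [hΔ, hr00]; simp
        rw [hv00, hΔ00]
        simpa using mixEnt_nonneg hX ha ha1 s'
      · have h1 := mixEnt_ge hX ha ha1 hk hSb hS h0 hv' hr (θ := 2 * Δ) (by positivity)
        rw [← hNdef, ← he, hvr] at h1
        have h2 : Δ * (1 - e * (1 - exp (-r)) - 1 / √(1 + 2 * (e * r))) = Δ ^ 2 := by
          rcases le_total (1 - e * (1 - exp (-r)) - 1 / √(1 + 2 * (e * r))) 0 with h3 | h3
          · rw [hΔ, max_eq_right h3]; ring
          · rw [hΔ, max_eq_left h3]; ring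
        have h3 : N * (2 * Δ * (1 / 2 * (1 - e * (1 - exp (-r)) - 1 / √(1 + 2 * (e * r)))) -
            (2 * Δ) ^ 2 / 8) = N * Δ ^ 2 / 2 := by
          linear_combination N * h2
        rwa [h3] at h1
    have hY : k * Sb * ((s' + h : ℝ≥0) : ℝ) / N = e * (((s' + h : ℝ≥0) : ℝ) * Sb) := by
      rw [he]; ring
    refine exponent_le_of_step_le (v' := v') (N := N) (Q := N * Δ ^ 2) (Ψ' := mixEnt X a s')
      (Ψ := mixEnt X a (s' + h)) ht ht1 hσ0 hσ1 hμ0 hμv hN hv'0 ?_ ?_ hent hD ?_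
    · rw [hv, hv', NNReal.coe_add, ← hσB, ← hhA]
      field_simp
      ring
    · rw [hμA] at hstep
      have h1 : (h : ℝ) / 2 * (k * B * (σ - μ)) = t * (σ - μ) / 2 := by
        rw [← hhA]; ring
      have h2 : k * B * (k * Sb) * (h : ℝ) ^ 2 / 4 = σ * t ^ 2 / 4 := by
        rw [← hhA, ← hσB]; ring
      rw [h1, h2] at hstep
      linarith
    · have hNe : N = k / e := by rw [he]; field_simp
      rw [hv, hY, hΔ]
      conv_rhs => rw [hNe]
      refine mul_div_one_add_le ht hk1' he0 he1 (by positivity) ?_ rfl hP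
      rw [hr, NNReal.coe_add]
      have h1 : (h : ℝ) * Sb ≤ 1 / 2 := by
        have h2 : (h : ℝ) * B ≤ t := by
          rw [← hhA]
          exact mul_le_mul_of_nonneg_left (le_mul_of_one_le_left hB.le hk1') h.coe_nonneg
        have h3 : (h : ℝ) * Sb ≤ h * B := mul_le_mul_of_nonneg_left hSB h.coe_nonneg
        linarith
      linarith
  · have hstep := mixEnt_add_ge_postSq_right hX ha hA hXA hS.symm 0 s
    have h0 := mixEnt_nonneg hX ha ha1 0
    rw [zero_add, hμA] at hstep
    have hlt' : (s : ℝ) < h := by exact_mod_cast hlt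
    have hT : (s : ℝ) * (k * B) < t := by
      rw [← hhA]; exact mul_lt_mul_of_pos_right hlt' hA
    have hmean := postSq_le_of_mean hX ha ha1 hA hXA s rfl
    rw [hS, hμA] at hmean
    refine exponent_le_of_lt_step (v := v) (e := e) (T := s * (k * B)) (N := N)
      (Ψ := mixEnt X a s) ht ht1 hσ0 hσ1 hμ0 (hμv.trans (div_le_self hσ0 (by linarith))) ?_
      (by positivity) hT he0.le hN ?_ ?_ ?_ hD ?_
    · have h1 : k * B * (σ - μ) ≤ k * B * (σ * (e + s * (k * B))) := by
        set bb := (∑ x ∈ X, a x • x) ⬝ᵥ (∑ x ∈ X, a x • x)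
        have hbb : 0 ≤ bb := dotProduct_self_nonneg' _
        have h2 : 0 ≤ k * B * s * bb := by positivity
        have h3 : k * B * (σ * (e + s * (k * B))) = e * (k * Sb) + k * B * s * (k * Sb) := by
          rw [← hσB]; ring
        linarith
      have := le_of_mul_le_mul_left h1 hA
      linarith
    · rw [he]
      have : N * (k / N) = k := by field_simp
      linarith
    · rw [hv, ← hσB]; field_simp
    · have h1 : k * B * (k * Sb) * (s : ℝ) ^ 2 / 4 = σ * (s * (k * B)) ^ 2 / 4 := by
        rw [← hσB]; ring
      rw [h1] at hstep
      linarith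
    · have h1 : t * e ≤ t * (k * (e / (1 - e))) := mul_le_mul_of_nonneg_left hee ht.le
      have h2 : 0 ≤ t * (k * (e / (1 - e))) * (7 / 8 * t) := by positivity
      linarith

end

lemma mul_exp_div_sq_mul_exp_le {A p r w D : ℝ} (hp : 0 < p) (hr : 0 < r) (hw : 0 < w)
    (h : A + log p - log r - 2 * log w ≤ 2 * D) : p * exp A / w ^ 2 * exp (-2 * D) ≤ r := by
  have h1 : p * exp A / w ^ 2 * exp (-2 * D) =
      exp (log p + A - (log w + log w) + -2 * D) := by
    rw [exp_add, exp_sub, exp_add, exp_add, exp_log hp, exp_log hw, sq]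
  rw [h1, ← Real.le_log_iff_exp_le hr]
  linarith

set_option maxHeartbeats 1000000 in
theorem kl_square_error_lower_bound
    (U : Finset ℝ) (hU : U.Nonempty) (hU0 : ∀ u ∈ U, u ≠ 0)
    (umax : ℝ) (humax : IsGreatest {t : ℝ | ∃ u ∈ U, t = |u|} umax)
    (k N : ℕ) (hk : 1 ≤ k) (hkN : k < N) (σ2 : ℝ) (hσ : 0 < σ2)
    (σt2 : ℝ) (hσt2 : σt2 = σ2 / Real.log ((N : ℝ) / (k : ℝ)))
    (Sbar : ℝ) (hSbar : Sbar = (∑ u ∈ U, u ^ 2) / U.card)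
    (lam : ℝ) (hlam : lam = 1 + (k : ℝ) * Sbar / ((N : ℝ) * σt2))
    (p q : Measure (Fin N → ℝ))
    (hp : p = Measure.map (fun pr : (Fin N → ℝ) × (Fin N → ℝ) => pr.1 + pr.2)
      ((uniformOn (sparseVecs U (Fin N) k)).prod
        (Measure.pi fun _ : Fin N => gaussianReal 0 σt2.toNNReal)))
    (hq : q = Measure.pi fun _ : Fin N => gaussianReal 0 (lam * σt2).toNNReal)
    (hD : klDiv p q ≠ ⊤)
    (xhat : (Fin N → ℝ) → (Fin N → ℝ)) (hmeas : Measurable xhat)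
    (α : ℝ) (hα0 : 0 < α) (hα1 : α < 1 / (2 * umax ^ 2))
    (fα : ℝ) (hfα : fα = Real.sqrt ((1 - umax ^ 4 * α ^ 2) / (1 - 2 * umax ^ 2 * α)) - 1)
    (CN : ℝ) (hCN : CN = (1 - umax ^ 4 * α ^ 2) * Real.exp (α * Sbar)
      / (1 + fα * ((1 + ((N : ℝ) / (k : ℝ) - 1)⁻¹) ^ k - 1)) ^ 2) :
    ENNReal.ofReal ((1 / α) * (CN * Real.exp (-2 * (klDiv p q).toReal) - 1)) ≤
      (k : ℝ≥0∞)⁻¹ *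
        ∫⁻ pr : (Fin N → ℝ) × (Fin N → ℝ),
          ENNReal.ofReal (∑ i, (pr.1 i - xhat (pr.1 + pr.2) i) ^ 2)
          ∂((uniformOn (sparseVecs U (Fin N) k)).prod
            (Measure.pi fun _ : Fin N => gaussianReal 0 σt2.toNNReal)) := by
  have hk0 : (0 : ℝ) < k := by exact_mod_cast hk
  have hkN' : (k : ℝ) < N := by exact_mod_cast hkN
  have hN0 : (0 : ℝ) < N := hk0.trans hkN'
  have : NeZero N := ⟨by omega⟩
  have hcard : (Fintype.card (Fin N) : ℝ) = N := by rw [Fintype.card_fin]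
  obtain ⟨⟨u₀, hu₀, rfl⟩, hub⟩ := humax
  set B := |u₀| ^ 2 with hBdef
  have hB : 0 < B := by have := abs_pos.2 (hU0 u₀ hu₀); positivity
  have huB : ∀ u ∈ U, u ^ 2 ≤ B := by
    intro u hu
    rw [← sq_abs u]
    exact pow_le_pow_left₀ (abs_nonneg u) (hub ⟨u, hu, rfl⟩) 2
  have hSbar0 : 0 ≤ Sbar := by rw [hSbar]; positivity
  have hSbarB : Sbar ≤ B := by
    have hc : (0 : ℝ) < U.card := by exact_mod_cast hU.card_pos
    rw [hSbar, div_le_iff₀ hc, mul_comm, ← nsmul_eq_mul]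
    exact Finset.sum_le_card_nsmul _ _ _ huB
  have hτ0 : 0 < σt2 := by
    rw [hσt2]
    exact div_pos hσ (Real.log_pos ((one_lt_div hk0).2 hkN'))
  set τ := σt2.toNNReal with hτdef
  have hτc : (τ : ℝ) = σt2 := Real.coe_toNNReal _ hτ0.le
  have hτne : τ ≠ 0 := (Real.toNNReal_pos.2 hτ0).ne'
  set X := sparseVecs U (Fin N) k with hXdef
  have hX : X.Nonempty := sparseVecs_nonempty hU hU0 (by rw [Fintype.card_fin]; exact hkN.le)
  have hc := card_inv_pos hX
  have hcX : (X.card : ℝ)⁻¹ * X.card = 1 :=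
    inv_mul_cancel₀ (by exact_mod_cast hX.card_pos.ne')
  have hS : ∑ x ∈ X, (X.card : ℝ)⁻¹ * (x ⬝ᵥ x) = k * Sbar := by
    rw [← Finset.mul_sum, sparseVecs_sum_dotProduct_self hU hU0, ← mul_assoc, hcX, one_mul, hSbar]
  have ha1 : ∑ x ∈ X, (fun _ : Fin N → ℝ => (X.card : ℝ)⁻¹) x = 1 := by
    rw [Finset.sum_const, nsmul_eq_mul, mul_comm, hcX]
  have hsτ : τ⁻¹ * τ = 1 := inv_mul_cancel₀ hτne
  obtain ⟨v, hv⟩ : ∃ v : ℝ, v = k * Sbar * (τ⁻¹ : ℝ≥0) / Fintype.card (Fin N) := ⟨_, rfl⟩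
  have hv0 : 0 ≤ v := by rw [hv]; positivity
  have hlamv : lam = 1 + v := by
    rw [hlam, hv, hcard, NNReal.coe_inv, hτc]
    field_simp
  have hlc : (lam.toNNReal : ℝ) = 1 + v := by
    rw [Real.coe_toNNReal _ (by linarith), hlamv]
  have hq' : q = gaussPi (Fin N) (lam.toNNReal * τ) := by
    rw [hq, Real.toNNReal_mul (by linarith)]
    rfl
  have hp' : p = ((_root_.uniformOn X).prod (gaussPi (Fin N) τ)).map fun z => z.1 + z.2 := hp
  have hDle := mixEnt_sub_le_klDiv hX hsτ hS hv hlc (by rw [← hp', ← hq']; exact hD)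
  rw [← hp', ← hq'] at hDle
  set D := (_root_.klDiv p q).toReal with hDdef
  set t := B * α with htdef
  have ht : 0 < t := mul_pos hB hα0
  have ht1 : t < 1 / 2 := by
    rw [lt_div_iff₀ (by positivity)] at hα1
    rw [htdef]
    linarith
  have e1 : |u₀| ^ 4 * α ^ 2 = t ^ 2 := by rw [htdef, hBdef]; ring
  have e2 : 2 * B * α = 2 * t := by rw [htdef]; ring
  rw [e1, e2] at hfα
  rw [e1] at hCN
  have hf : t + t ^ 2 ≤ fα := by rw [hfα]; exact add_sq_le_sqrt_sub_one ht ht1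
  set β := (1 + ((N : ℝ) / (k : ℝ) - 1)⁻¹) ^ k - 1 with hβdef
  have hβ := mul_div_one_sub_le_pow hk hkN
  have hβ0 : 0 ≤ β := by
    refine le_trans ?_ hβ
    have : 0 ≤ 1 - (k : ℝ) / N := by rw [sub_nonneg, div_le_one hN0]; exact hkN'.le
    positivity
  set m := k * Sbar - postSq X (fun _ => (X.card : ℝ)⁻¹) τ⁻¹ with hm
  have hm0 : 0 ≤ m := by
    have := postSq_le hX (a := fun _ => (X.card : ℝ)⁻¹) (fun _ _ => hc) τ⁻¹
    rw [hS] at this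
    linarith
  have hexp := exponent_le hX (a := fun _ => (X.card : ℝ)⁻¹) (fun _ _ => hc) ha1 hk
    (by rw [Fintype.card_fin]; exact hkN) (fun x hx => (mem_sparseVecs.1 hx).2) hB hSbar0 hSbarB
    (fun x hx => sparseVecs_dotProduct_self_le huB hx) hS
    (normSq_mean_sparseVecs_le hc.le hcX hS) (inv_ne_zero hτne) hv ENNReal.toReal_nonneg hDle
    ht ht1 hf (β := β) (by rw [hcard]; exact hβ) rfl
  have e3 : t * (Sbar / B) = α * Sbar := by rw [htdef]; field_simp
  have hw : 0 < 1 + fα * β := by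
    have := mul_nonneg (le_trans (by positivity) hf) hβ0
    linarith
  rw [e3] at hexp
  have hr0 : 0 < 1 + t * (m / (k * B)) := by positivity
  have hCND := mul_exp_div_sq_mul_exp_le (by nlinarith) hr0 hw hexp
  rw [← hCN] at hCND
  have hle : (1 / α) * (CN * Real.exp (-2 * D) - 1) ≤ (k : ℝ)⁻¹ * m := by
    rw [one_div_mul_eq_div, div_le_iff₀ hα0]
    have e4 : t * (m / (k * B)) = (k : ℝ)⁻¹ * m * α := by rw [htdef]; field_simp
    linarith
  refine (ENNReal.ofReal_le_ofReal hle).trans ?_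
  rw [ENNReal.ofReal_mul (by positivity), ENNReal.ofReal_inv_of_pos hk0, ENNReal.ofReal_natCast]
  have hlow := sub_postSq_le_lintegral hX hsτ hmeas
  rw [hS] at hlow
  exact mul_le_mul_right hlow _
end

section
/- A Gaussian quadratic-exponential moment identity: let k ≥ 1 be a natural, let a ∈ ℝ^k have i.i.d. standard Gaussian N(0,1) entries, and let v ∈ ℝ and u₁, u₂ ∈ ℝ^k be deterministic. If (1 − ⟨u₂, u₁⟩)² > (2v + ‖u₂‖₂²)·‖u₁‖₂², then E[ exp( ⟨a, u₁⟩·( v·⟨a, u₁⟩ + ⟨a, u₂⟩ ) ) ] = ( (1 − ⟨u₂, u₁⟩)² − (2v + ‖u₂‖₂²)·‖u₁‖₂² )^{−1/2}, the integrand being integrable under the stated condition. -/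
open MeasureTheory ProbabilityTheory Real
open scoped ENNReal NNReal

section GaussianQuadratic

open scoped RealInnerProductSpace

/-- The moment generating function of the square of a standard Gaussian variable. -/
lemma integral_exp_mul_sq_gaussianReal_zero_one {c : ℝ} (hc : 2 * c < 1) :
    Integrable (fun x : ℝ => exp (c * x ^ 2)) (gaussianReal 0 1) ∧
      ∫ x, exp (c * x ^ 2) ∂(gaussianReal 0 1) = (1 - 2 * c) ^ (-(1 / 2 : ℝ)) := by
  have hb : 0 < 1 / 2 - c := by linarith
  have hpdf (x : ℝ) : gaussianPDFReal 0 1 x * exp (c * x ^ 2)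
      = (√(2 * π))⁻¹ * exp (-(1 / 2 - c) * x ^ 2) := by
    simp only [gaussianPDFReal, NNReal.coe_one, mul_one, sub_zero]
    rw [mul_assoc, ← exp_add]
    ring_nf
  constructor
  · rw [gaussianReal_of_var_ne_zero 0 one_ne_zero,
      integrable_withDensity_iff_integrable_smul' (measurable_gaussianPDF 0 1)
        (ae_of_all _ fun _ => gaussianPDF_lt_top)]
    simp only [toReal_gaussianPDF, smul_eq_mul, hpdf]
    exact (integrable_exp_neg_mul_sq hb).const_mul _
  · rw [integral_gaussianReal_eq_integral_smul one_ne_zero]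
    simp only [smul_eq_mul, hpdf]
    rw [integral_const_mul, integral_gaussian, ← sqrt_inv, ← sqrt_mul (by positivity),
      rpow_neg (by linarith), ← sqrt_eq_rpow, ← sqrt_inv]
    congr 1
    have : 1 - 2 * c ≠ 0 := by linarith
    have : 1 / 2 - c ≠ 0 := hb.ne'
    field_simp

/-- The moment generating function of the square of a centered Gaussian variable of
variance `r ^ 2`. -/
lemma HasLaw.integral_exp_mul_sq {Ω : Type*} {mΩ : MeasurableSpace Ω} {P : Measure Ω} {X : Ω → ℝ}
    {r c : ℝ} (hX : HasLaw X (gaussianReal 0 (.mk (r ^ 2) (sq_nonneg r))) P)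
    (hc : 2 * (c * r ^ 2) < 1) :
    Integrable (fun ω => exp (c * X ω ^ 2)) P ∧
      ∫ ω, exp (c * X ω ^ 2) ∂P = (1 - 2 * (c * r ^ 2)) ^ (-(1 / 2 : ℝ)) := by
  have hmap : P.map X = (gaussianReal 0 1).map (r * ·) := by
    rw [hX.map_eq, gaussianReal_map_const_mul]
    simp
  have hsm (μ : Measure ℝ) : AEStronglyMeasurable (fun x : ℝ => exp (c * x ^ 2)) μ := by fun_prop
  have hr := integral_exp_mul_sq_gaussianReal_zero_one hc
  simp only [mul_assoc, ← mul_pow] at hr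
  rw [← integral_map hX.aemeasurable (hsm _) (f := fun x => exp (c * x ^ 2)), hmap,
    integral_map (by fun_prop) (hsm _)]
  refine ⟨?_, hr.2⟩
  have : Integrable (fun x => exp (c * x ^ 2)) (P.map X) := by
    rw [hmap, integrable_map_measure (hsm _) (by fun_prop)]
    exact hr.1
  exact this.comp_aemeasurable hX.aemeasurable

variable {E : Type*} [NormedAddCommGroup E] [InnerProductSpace ℝ E]

/-- A product of two linear forms is a difference of squares of orthogonal linear forms. -/
lemma exists_orthogonal_inner_mul_inner_eq_sq_sub_sq (u w : E) :
    ∃ p q : E, ⟪p, q⟫ = 0 ∧ (∀ x, ⟪u, x⟫ * ⟪w, x⟫ = ⟪p, x⟫ ^ 2 - ⟪q, x⟫ ^ 2) ∧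
      2 * ‖p‖ ^ 2 = ‖u‖ * ‖w‖ + ⟪u, w⟫ ∧ 2 * ‖q‖ ^ 2 = ‖u‖ * ‖w‖ - ⟪u, w⟫ := by
  by_cases hu : u = 0
  · exact ⟨0, 0, by simp [hu]⟩
  by_cases hw : w = 0
  · exact ⟨0, 0, by simp [hw]⟩
  have hu' : 0 < ‖u‖ := norm_pos_iff.2 hu
  have hw' : 0 < ‖w‖ := norm_pos_iff.2 hw
  obtain ⟨t, ht, htsq⟩ : ∃ t : ℝ, 0 < t ∧ t ^ 2 = ‖w‖ / ‖u‖ :=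
    ⟨√(‖w‖ / ‖u‖), by positivity, sq_sqrt (by positivity)⟩
  have htu : t ^ 2 * ‖u‖ ^ 2 = ‖u‖ * ‖w‖ := by rw [htsq]; field_simp
  have htw : (t⁻¹) ^ 2 * ‖w‖ ^ 2 = ‖u‖ * ‖w‖ := by rw [inv_pow, htsq]; field_simp
  have htt : t * t⁻¹ = 1 := mul_inv_cancel₀ ht.ne'
  refine ⟨(1 / 2 : ℝ) • (t • u + t⁻¹ • w), (1 / 2 : ℝ) • (t • u - t⁻¹ • w), ?_, fun x => ?_, ?_, ?_⟩
  · simp only [inner_smul_left, inner_smul_right, inner_add_left, inner_sub_right,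
      real_inner_self_eq_norm_sq, real_inner_comm u w, conj_trivial]
    linear_combination (1 / 4) * htu - (1 / 4) * htw
  · simp only [inner_smul_left, inner_add_left, inner_sub_left, conj_trivial]
    linear_combination (-⟪u, x⟫ * ⟪w, x⟫) * htt
  · rw [← real_inner_self_eq_norm_sq]
    simp only [inner_smul_left, inner_smul_right, inner_add_left, inner_add_right,
      real_inner_self_eq_norm_sq, real_inner_comm u w, conj_trivial]
    linear_combination (1 / 2) * htu + (1 / 2) * htw + ⟪u, w⟫ * htt
  · rw [← real_inner_self_eq_norm_sq]
    simp only [inner_smul_left, inner_smul_right, inner_sub_left, inner_sub_right,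
      real_inner_self_eq_norm_sq, real_inner_comm u w, conj_trivial]
    linear_combination (1 / 2) * htu + (1 / 2) * htw - ⟪u, w⟫ * htt

variable [FiniteDimensional ℝ E] [MeasurableSpace E] [BorelSpace E]

lemma hasLaw_inner_stdGaussian (p : E) :
    HasLaw (fun x => ⟪p, x⟫) (gaussianReal 0 (.mk (‖p‖ ^ 2) (sq_nonneg _))) (stdGaussian E) where
  aemeasurable := by fun_prop
  map_eq := by
    have h : HasGaussianLaw (innerSL ℝ p) (stdGaussian E) :=
      IsGaussian.hasGaussianLaw_id.map (innerSL ℝ p)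
    have hmap := h.map_eq_gaussianReal
    rw [integral_strongDual_stdGaussian, variance_dual_stdGaussian, innerSL_apply_norm,
      toNNReal_of_nonneg (sq_nonneg _)] at hmap
    exact hmap

lemma indepFun_inner_stdGaussian {p q : E} (hpq : ⟪p, q⟫ = 0) :
    IndepFun (fun x => ⟪p, x⟫) (fun x => ⟪q, x⟫) (stdGaussian E) := by
  refine HasGaussianLaw.indepFun_of_covariance_eq_zero
    (IsGaussian.hasGaussianLaw_id.map ((innerSL ℝ p).prod (innerSL ℝ q))) ?_
  rw [← covarianceBilin_apply_eq_cov IsGaussian.memLp_two_id, covarianceBilin_stdGaussian]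
  exact hpq

/-- The exponential moment of a product of two linear forms under the standard Gaussian measure. -/
lemma integral_exp_inner_mul_inner_stdGaussian {u w : E}
    (h : ‖u‖ ^ 2 * ‖w‖ ^ 2 < (1 - ⟪u, w⟫) ^ 2) :
    Integrable (fun x => exp (⟪u, x⟫ * ⟪w, x⟫)) (stdGaussian E) ∧
      ∫ x, exp (⟪u, x⟫ * ⟪w, x⟫) ∂(stdGaussian E)
        = ((1 - ⟪u, w⟫) ^ 2 - ‖u‖ ^ 2 * ‖w‖ ^ 2) ^ (-(1 / 2 : ℝ)) := by
  obtain ⟨p, q, hpq, hdiff, hp, hq⟩ := exists_orthogonal_inner_mul_inner_eq_sq_sub_sq u w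
  have hq' : 0 < 1 - ⟪u, w⟫ + ‖u‖ * ‖w‖ := by nlinarith [sq_nonneg ‖q‖]
  have hp' : 0 < 1 - ⟪u, w⟫ - ‖u‖ * ‖w‖ := by
    refine pos_of_mul_pos_left ?_ hq'.le
    linear_combination h
  obtain ⟨hpi, hpv⟩ := HasLaw.integral_exp_mul_sq (c := 1) (hasLaw_inner_stdGaussian p)
    (by linarith)
  obtain ⟨hqi, hqv⟩ := HasLaw.integral_exp_mul_sq (c := -1) (hasLaw_inner_stdGaussian q)
    (by linarith)
  have hind : IndepFun (fun x => exp (1 * ⟪p, x⟫ ^ 2)) (fun x => exp (-1 * ⟪q, x⟫ ^ 2))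
      (stdGaussian E) :=
    (indepFun_inner_stdGaussian hpq).comp (φ := fun y => exp (1 * y ^ 2))
      (ψ := fun y => exp (-1 * y ^ 2)) (by fun_prop) (by fun_prop)
  have hexp (x : E) : exp (⟪u, x⟫ * ⟪w, x⟫)
      = exp (1 * ⟪p, x⟫ ^ 2) * exp (-1 * ⟪q, x⟫ ^ 2) := by
    rw [hdiff, ← exp_add]
    ring_nf
  simp only [hexp]
  refine ⟨hind.integrable_mul hpi hqi, ?_⟩
  rw [hind.integral_fun_mul_eq_mul_integral hpi.aestronglyMeasurable hqi.aestronglyMeasurable,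
    hpv, hqv, ← mul_rpow (by linarith) (by linarith)]
  congr 1
  linear_combination (-(1 + 2 * ‖q‖ ^ 2)) * hp + (1 - ‖u‖ * ‖w‖ - ⟪u, w⟫) * hq

end GaussianQuadratic

theorem gaussian_quadratic_exponential_moment
    (k : ℕ) (hk : 1 ≤ k) (v : ℝ) (u₁ u₂ : Fin k → ℝ)
    (h : (2 * v + ∑ i, (u₂ i) ^ 2) * (∑ i, (u₁ i) ^ 2) < (1 - ∑ i, u₂ i * u₁ i) ^ 2) :
    Integrable (fun a : Fin k → ℝ =>
        Real.exp ((∑ i, a i * u₁ i) * (v * (∑ i, a i * u₁ i) + ∑ i, a i * u₂ i)))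
      (Measure.pi fun _ : Fin k => gaussianReal 0 1) ∧
    ∫ a : Fin k → ℝ,
        Real.exp ((∑ i, a i * u₁ i) * (v * (∑ i, a i * u₁ i) + ∑ i, a i * u₂ i))
        ∂(Measure.pi fun _ : Fin k => gaussianReal 0 1)
      = ((1 - ∑ i, u₂ i * u₁ i) ^ 2
          - (2 * v + ∑ i, (u₂ i) ^ 2) * (∑ i, (u₁ i) ^ 2)) ^ (-(1 / 2 : ℝ)) := by
  let U₁ : EuclideanSpace ℝ (Fin k) := WithLp.toLp 2 u₁
  let U₂ : EuclideanSpace ℝ (Fin k) := WithLp.toLp 2 u₂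
  have hinner (b a : Fin k → ℝ) :
      inner ℝ (WithLp.toLp 2 b : EuclideanSpace ℝ (Fin k)) (WithLp.toLp 2 a) = ∑ i, a i * b i := by
    simp [PiLp.inner_apply]
  have hn₁ : ‖U₁‖ ^ 2 = ∑ i, u₁ i ^ 2 := EuclideanSpace.real_norm_sq_eq U₁
  have hn₂ : ‖U₂‖ ^ 2 = ∑ i, u₂ i ^ 2 := EuclideanSpace.real_norm_sq_eq U₂
  have h₁₂ : inner ℝ U₁ U₂ = ∑ i, u₂ i * u₁ i := hinner u₁ u₂
  have hexp (a : Fin k → ℝ) :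
      (∑ i, a i * u₁ i) * (v * (∑ i, a i * u₁ i) + ∑ i, a i * u₂ i)
        = inner ℝ U₁ (WithLp.toLp 2 a) * inner ℝ (v • U₁ + U₂) (WithLp.toLp 2 a) := by
    rw [inner_add_left, inner_smul_left, hinner, hinner, conj_trivial]
  have hdet : (1 - inner ℝ U₁ (v • U₁ + U₂)) ^ 2 - ‖U₁‖ ^ 2 * ‖v • U₁ + U₂‖ ^ 2
      = (1 - inner ℝ U₁ U₂) ^ 2 - (2 * v + ‖U₂‖ ^ 2) * ‖U₁‖ ^ 2 := by
    rw [← real_inner_self_eq_norm_sq (v • U₁ + U₂)]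
    simp only [inner_smul_left, inner_smul_right, inner_add_left, inner_add_right,
      real_inner_self_eq_norm_sq, real_inner_comm U₁ U₂, conj_trivial]
    ring
  rw [← hn₁, ← hn₂, ← h₁₂] at h ⊢
  obtain ⟨hi, hv⟩ := integral_exp_inner_mul_inner_stdGaussian (u := U₁) (w := v • U₁ + U₂)
    (by linarith)
  simp only [hexp]
  rw [← map_pi_eq_stdGaussian] at hi hv
  refine ⟨hi.comp_aemeasurable (by fun_prop), ?_⟩
  rw [← hdet, ← hv, integral_map (by fun_prop) (by fun_prop)]
end
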